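/- Let I ⊂ R = k[x,y,z] be the radical ideal of a set X of n distinct points of P² in generic n-position, with initial degree s ≥ 2, and write n = C(s+1,2) + h with 0 ≤ h ≤ s. Then the Castelnuovo–Mumford regularity of I satisfies: reg I = s if n = C(s+1,2) (i.e., h = 0), and reg I = s+1 otherwise. -/

import Mathlib

open Matrix MvPolynomial

noncomputable section

def idealHeight {A : Type*} [CommRing A] (I : Ideal A) : ℕ∞ :=
  ⨅ (P : PrimeSpectrum A) (_ : I ≤ P.asIdeal), Order.height P

def minorsIdeal {A : Type*} [CommRing A] {p q : ℕ} (t : ℕ)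
    (M : Matrix (Fin p) (Fin q) A) : Ideal A :=
  Ideal.span { x | ∃ (r : Fin t → Fin p) (c : Fin t → Fin q),
    Function.Injective r ∧ Function.Injective c ∧ x = (M.submatrix r c).det }

/-- Condition `G_s` of Artin–Nagata: for every prime `P ⊇ L` with `ht P ≤ s − 1`,
the localization `L_P` can be generated by at most `ht P` elements. -/
def CondG {A : Type*} [CommRing A] (L : Ideal A) (s : ℕ) : Prop :=
  ∀ P : Ideal A, P.IsPrime → L ≤ P → idealHeight P + 1 ≤ (s : ℕ∞) →
    ∃ c : ℕ, (c : ℕ∞) ≤ idealHeight P ∧ ∃ g : Fin c → A, (∀ i, g i ∈ L) ∧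
      ∀ x ∈ L, ∃ u ∉ P, u * x ∈ Ideal.span (Set.range g)

/-- The skew-symmetric matrix of signed `m × m` minors (obtained by omitting two columns)
of an `m × (m+2)` matrix; this is the middle differential of the Buchsbaum–Rim complex. -/
def bbrim {A : Type*} [CommRing A] {m : ℕ} (ψ : Matrix (Fin m) (Fin (m + 2)) A) :
    Matrix (Fin (m + 2)) (Fin (m + 2)) A :=
  Matrix.of fun i j =>
    if h : (i : ℕ) < (j : ℕ) then
      (-1) ^ ((i : ℕ) + (j : ℕ)) *
        (ψ.submatrix id (fun q => j.succAbove
          ((⟨(i : ℕ), by have := j.isLt; omega⟩ : Fin (m + 1)).succAbove q))).det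
    else if h' : (j : ℕ) < (i : ℕ) then
      (-1) ^ ((i : ℕ) + (j : ℕ) + 1) *
        (ψ.submatrix id (fun q => i.succAbove
          ((⟨(j : ℕ), by have := i.isLt; omega⟩ : Fin (m + 1)).succAbove q))).det
    else 0

def rowMap {A : Type*} [CommRing A] {ι : Type*} [Fintype ι] (g : ι → A) :
    (ι → A) →ₗ[A] A :=
  ∑ i, g i • LinearMap.proj i

/-- Data of a (necessarily minimal) graded free resolution
`0 → ⊕_j R(−a_j) → ⊕_i R(−b_i) → I → 0` of an ideal of a polynomial ring. -/
def HasResolutionData {A : Type*} [CommRing A] {σ : Type*} (I : Ideal (MvPolynomial σ A))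
    {N M : ℕ} (b : Fin N → ℕ) (a : Fin M → ℕ) : Prop :=
  ∃ (g : Fin N → MvPolynomial σ A) (φ : Matrix (Fin N) (Fin M) (MvPolynomial σ A)),
    (∀ i, (g i).IsHomogeneous (b i)) ∧ Ideal.span (Set.range g) = I ∧
    (∀ i j, (φ i j).IsHomogeneous (a j - b i) ∧ (a j ≤ b i → φ i j = 0)) ∧
    Function.Injective φ.mulVecLin ∧
    LinearMap.range φ.mulVecLin = LinearMap.ker (rowMap g)

/-- The Castelnuovo–Mumford regularity of a codimension-two perfect ideal, read off from
its minimal graded free resolution `0 → ⊕_j R(−a_j) → ⊕_i R(−b_i) → I → 0` as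
`max(max_i b_i, max_j a_j − 1)`. -/
def HasRegularity {A : Type*} [CommRing A] {σ : Type*} (I : Ideal (MvPolynomial σ A))
    (r : ℕ) : Prop :=
  ∃ (N M : ℕ) (b : Fin N → ℕ) (a : Fin M → ℕ), HasResolutionData I b a ∧
    (Finset.univ.sup b) ⊔ ((Finset.univ.sup a) - 1) = r

def IsCohenMacaulayRing (A : Type*) [CommRing A] : Prop :=
  ∀ P : Ideal A, P.IsMaximal → ∃ rs : List A,
    (∀ x ∈ rs, x ∈ P) ∧ RingTheory.Sequence.IsRegular A rs ∧
      (rs.length : ℕ∞) = idealHeight P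

def reesPresentation {A : Type*} [CommRing A] {n : ℕ} (f : Fin n → A) :
    MvPolynomial (Fin n) A →ₐ[A] Polynomial A :=
  MvPolynomial.aeval fun i => Polynomial.C (f i) * Polynomial.X

def Ideal.IsLinearType {A : Type*} [CommRing A] (I : Ideal A) : Prop :=
  ∀ (n : ℕ) (f : Fin n → A), Ideal.span (Set.range f) = I →
    RingHom.ker (reesPresentation f) =
      Ideal.span {p | p ∈ RingHom.ker (reesPresentation f) ∧ p.IsHomogeneous 1}

def moduleDepth {A : Type*} [CommRing A] (J : Ideal A) (M : Type*)
    [AddCommGroup M] [Module A M] : ℕ∞ :=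
  sSup {c : ℕ∞ | ∃ rs : List A, (∀ x ∈ rs, x ∈ J) ∧
    RingTheory.Sequence.IsRegular M rs ∧ (rs.length : ℕ∞) = c}

def analyticSpread {A : Type*} [CommRing A] (m I : Ideal A) : WithBot ℕ∞ :=
  ringKrullDim ((reesAlgebra I) ⧸ (Ideal.map (algebraMap A (reesAlgebra I)) m))

section Points

variable {k : Type*} [Field k]

def gradedPiece (I : Ideal (MvPolynomial (Fin 3) k)) (t : ℕ) :
    Submodule k (MvPolynomial (Fin 3) k) :=
  Submodule.restrictScalars k I ⊓ homogeneousSubmodule (Fin 3) k t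

def pointIdeal (p : Fin 3 → k) : Ideal (MvPolynomial (Fin 3) k) :=
  Ideal.span {f | f.IsHomogeneous 1 ∧ MvPolynomial.eval p f = 0}

def vanishingIdeal {n : ℕ} (pts : Fin n → (Fin 3 → k)) : Ideal (MvPolynomial (Fin 3) k) :=
  ⨅ i, pointIdeal (pts i)

def oneTimesPiece (I : Ideal (MvPolynomial (Fin 3) k)) (s : ℕ) :
    Submodule k (MvPolynomial (Fin 3) k) :=
  Submodule.span k {g | ∃ ℓ f, ℓ ∈ homogeneousSubmodule (Fin 3) k 1 ∧
    f ∈ gradedPiece I s ∧ g = ℓ * f}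

def IsPointFamily {n : ℕ} (pts : Fin n → (Fin 3 → k)) : Prop :=
  (∀ i, pts i ≠ 0) ∧ ∀ i j, i ≠ j → ∀ c : k, pts i ≠ c • pts j

def InGenericPosition {n : ℕ} (pts : Fin n → (Fin 3 → k)) : Prop :=
  ∀ t : ℕ, Module.finrank k (gradedPiece (vanishingIdeal pts) t) = (t + 2).choose 2 - n

def InUniformPosition {n : ℕ} (pts : Fin n → (Fin 3 → k)) : Prop :=
  ∀ T : Finset (Fin n), ∀ t : ℕ,
    Module.finrank k (gradedPiece (⨅ i ∈ T, pointIdeal (pts i)) t) = (t + 2).choose 2 - T.card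

def HasInitialDegree (I : Ideal (MvPolynomial (Fin 3) k)) (s : ℕ) : Prop :=
  gradedPiece I s ≠ ⊥ ∧ ∀ t < s, gradedPiece I t = ⊥

def InTightGenericPosition {n : ℕ} (pts : Fin n → (Fin 3 → k)) (s : ℕ) : Prop :=
  InGenericPosition pts ∧
    Module.finrank k (oneTimesPiece (vanishingIdeal pts) s) =
      min (3 * Module.finrank k (gradedPiece (vanishingIdeal pts) s))
        (Module.finrank k (gradedPiece (vanishingIdeal pts) (s + 1)))

def IsBirationalOntoImage {N : ℕ} (f : Fin N → MvPolynomial (Fin 3) k) : Prop :=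
  ∃ (e : ℕ) (G : Fin 3 → MvPolynomial (Fin N) k) (w : MvPolynomial (Fin 3) k),
    w ≠ 0 ∧ (∀ j, (G j).IsHomogeneous e) ∧
      ∀ j, MvPolynomial.aeval f (G j) = w * MvPolynomial.X j

end Points

end

section Graded

variable {σ A : Type*} [CommRing A]

attribute [local instance] MvPolynomial.gradedAlgebra

lemma decompose_coe (f : MvPolynomial σ A) (j : ℕ) :
    (DirectSum.decompose (homogeneousSubmodule σ A) f j : MvPolynomial σ A) =
      homogeneousComponent j f :=
  decomposition.decompose'_apply f j

lemma homogeneousComponent_mul_of_isHomogeneous_left {l : MvPolynomial σ A} {i : ℕ}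
    (hl : l.IsHomogeneous i) (j : ℕ) (f : MvPolynomial σ A) :
    homogeneousComponent (i + j) (l * f) = l * homogeneousComponent j f := by
  have := DirectSum.coe_decompose_mul_add_of_left_mem (homogeneousSubmodule σ A)
    (a := l) (b := f) (i := i) (j := j) hl
  rwa [decompose_coe, decompose_coe] at this

lemma homogeneousComponent_mul_of_lt {l : MvPolynomial σ A} {i d : ℕ}
    (hl : l.IsHomogeneous i) (hd : d < i) (f : MvPolynomial σ A) :
    homogeneousComponent d (l * f) = 0 := by
  have := DirectSum.coe_decompose_mul_of_left_mem_of_not_le (homogeneousSubmodule σ A)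
    (a := l) (b := f) (i := i) (n := d) hl (by omega)
  rwa [decompose_coe] at this

/-- The homogeneous polynomials of degree `d - b`, read as `⊥` if `d < b`; this is the degree `d`
part of the twist by `-b` of the polynomial ring. -/
noncomputable def shiftPiece (σ A : Type*) [CommRing A] (d b : ℕ) : Submodule A (MvPolynomial σ A) :=
  if b ≤ d then homogeneousSubmodule σ A (d - b) else ⊥

/-- The projection onto `shiftPiece`. -/
noncomputable def shiftComponent (d b : ℕ) : MvPolynomial σ A →ₗ[A] MvPolynomial σ A :=
  if b ≤ d then homogeneousComponent (d - b) else 0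

lemma mem_shiftPiece_add {b e : ℕ} {f : MvPolynomial σ A} :
    f ∈ shiftPiece σ A (b + e) b ↔ f.IsHomogeneous e := by
  simp [shiftPiece]

lemma eq_zero_of_mem_shiftPiece {d b : ℕ} (h : d < b) {f : MvPolynomial σ A}
    (hf : f ∈ shiftPiece σ A d b) : f = 0 := by
  simpa [shiftPiece, not_le.2 h] using hf

lemma isHomogeneous_of_mem_shiftPiece {d b : ℕ} {f : MvPolynomial σ A}
    (hf : f ∈ shiftPiece σ A d b) : f.IsHomogeneous (d - b) := by
  unfold shiftPiece at hf
  split_ifs at hf with h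
  · exact hf
  · rw [(Submodule.mem_bot A).1 hf]
    exact isHomogeneous_zero _ _ _

lemma mul_mem_shiftPiece {c d b : ℕ} {l f : MvPolynomial σ A}
    (hl : l.IsHomogeneous c) (hf : f ∈ shiftPiece σ A d b) :
    l * f ∈ shiftPiece σ A (c + d) b := by
  by_cases h : b ≤ d
  · obtain ⟨e, rfl⟩ := Nat.exists_eq_add_of_le h
    rw [mem_shiftPiece_add] at hf
    rw [add_left_comm, mem_shiftPiece_add]
    exact hl.mul hf
  · rw [eq_zero_of_mem_shiftPiece (by omega) hf, mul_zero]
    exact zero_mem _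

lemma shiftComponent_eq_self {d b : ℕ} {f : MvPolynomial σ A}
    (hf : f ∈ shiftPiece σ A d b) : shiftComponent d b f = f := by
  unfold shiftPiece at hf
  unfold shiftComponent
  split_ifs at hf ⊢ with h
  · rw [homogeneousComponent_of_mem hf, if_pos rfl]
  · rw [(Submodule.mem_bot A).1 hf, map_zero]

lemma shiftComponent_mem (d b : ℕ) (f : MvPolynomial σ A) :
    shiftComponent d b f ∈ shiftPiece σ A d b := by
  unfold shiftPiece shiftComponent
  split_ifs
  · exact homogeneousComponent_mem _ _
  · exact zero_mem _

lemma shiftComponent_linear_mul {l : MvPolynomial σ A} (hl : l.IsHomogeneous 1) (d b : ℕ)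
    (f : MvPolynomial σ A) : shiftComponent (d + 1) b (l * f) = l * shiftComponent d b f := by
  unfold shiftComponent
  rcases lt_trichotomy b (d + 1) with h | h | h
  · rw [if_pos h.le, if_pos (by omega), show d + 1 - b = 1 + (d - b) by omega,
      homogeneousComponent_mul_of_isHomogeneous_left hl]
  · rw [if_pos h.le, if_neg (by omega), h, Nat.sub_self,
      homogeneousComponent_mul_of_lt hl one_pos]
    simp
  · rw [if_neg (by omega), if_neg (by omega)]
    simp

lemma shiftComponent_mul_right {g : MvPolynomial σ A} {b : ℕ} (hg : g.IsHomogeneous b) (d : ℕ)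
    (f : MvPolynomial σ A) : shiftComponent d b f * g = homogeneousComponent d (f * g) := by
  unfold shiftComponent
  rw [mul_comm f g]
  split_ifs with h
  · obtain ⟨e, rfl⟩ := Nat.exists_eq_add_of_le h
    rw [homogeneousComponent_mul_of_isHomogeneous_left hg, Nat.add_sub_cancel_left, mul_comm]
  · rw [homogeneousComponent_mul_of_lt hg (by omega)]
    simp

lemma exists_sum_shiftComponent {ι : Type*} [Finite ι] (b : ι → ℕ) (v : ι → MvPolynomial σ A) :
    ∃ D, ∀ i, v i = ∑ d ∈ Finset.range D, shiftComponent d (b i) (v i) := by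
  cases nonempty_fintype ι
  refine ⟨∑ i, (b i + ((v i).totalDegree + 1)), fun i => ?_⟩
  have hle : b i + ((v i).totalDegree + 1) ≤ ∑ i, (b i + ((v i).totalDegree + 1)) :=
    Finset.single_le_sum (f := fun i => b i + ((v i).totalDegree + 1))
      (fun _ _ => Nat.zero_le _) (Finset.mem_univ i)
  obtain ⟨m, hm⟩ := Nat.exists_eq_add_of_le hle
  rw [hm, add_assoc, Finset.sum_range_add, Finset.sum_range_add]
  rw [Finset.sum_eq_zero fun d hd => ?_, zero_add,
    Finset.sum_congr rfl fun d _ => ?_, sum_homogeneousComponent, Finset.sum_eq_zero fun d hd => ?_,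
    add_zero]
  · rw [shiftComponent, if_pos (by omega), homogeneousComponent_eq_zero _ _ (by omega)]
  · rw [shiftComponent, if_pos (by omega), Nat.add_sub_cancel_left]
  · rw [shiftComponent, if_neg (by simpa using hd), LinearMap.zero_apply]

end Graded

section Frame

variable {k : Type*} [Field k]

/-- Linear forms `x, y, z` forming a coordinate system in which `q = (1 : 0 : 0)`. -/
structure IsFrame (q : Fin 3 → k) (x y z : MvPolynomial (Fin 3) k) : Prop where
  x_hom : x.IsHomogeneous 1
  y_hom : y.IsHomogeneous 1
  z_hom : z.IsHomogeneous 1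
  eval_x : eval q x = 1
  eval_y : eval q y = 0
  eval_z : eval q z = 0
  mem_span : ∀ l : MvPolynomial (Fin 3) k, l.IsHomogeneous 1 → l ∈ Submodule.span k {x, y, z}
  exact : ∀ a b, y * a + z * b = 0 → ∃ c, a = z * c ∧ b = -(y * c)

variable {q : Fin 3 → k} {x y z : MvPolynomial (Fin 3) k}

lemma IsFrame.decompose (F : IsFrame q x y z) {t : ℕ} {f : MvPolynomial (Fin 3) k}
    (hf : f.IsHomogeneous (t + 1)) :
    ∃ f₀ f₁ f₂ : MvPolynomial (Fin 3) k, f₀.IsHomogeneous t ∧ f₁.IsHomogeneous t ∧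
      f₂.IsHomogeneous t ∧ f = x * f₀ + y * f₁ + z * f₂ := by
  have hf' : f ∈ homogeneousSubmodule (Fin 3) k 1 * homogeneousSubmodule (Fin 3) k t := by
    rw [← homogeneousSubmodule_one_pow (σ := Fin 3) (R := k) t, ← pow_succ',
      homogeneousSubmodule_one_pow]
    exact hf
  induction hf' using Submodule.mul_induction_on' with
  | mem_mul_mem l hl r hr =>
    obtain ⟨a, b, c, rfl⟩ := Submodule.mem_span_triple.1 (F.mem_span l hl)
    exact ⟨a • r, b • r, c • r, Submodule.smul_mem _ a hr, Submodule.smul_mem _ b hr,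
      Submodule.smul_mem _ c hr, by simp only [add_mul, smul_mul_assoc, mul_smul_comm]⟩
  | add a ha b hb iha ihb =>
    have h11 : (homogeneousSubmodule (Fin 3) k 1 * homogeneousSubmodule (Fin 3) k t) =
        homogeneousSubmodule (Fin 3) k (t + 1) := by
      rw [← homogeneousSubmodule_one_pow (σ := Fin 3) (R := k) t, ← pow_succ',
      homogeneousSubmodule_one_pow]
    rw [h11] at ha hb
    obtain ⟨a₀, a₁, a₂, h₀, h₁, h₂, e⟩ := iha ha
    obtain ⟨b₀, b₁, b₂, h₀', h₁', h₂', e'⟩ := ihb hb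
    exact ⟨a₀ + b₀, a₁ + b₁, a₂ + b₂, h₀.add h₀', h₁.add h₁', h₂.add h₂', by
      conv_lhs => rw [e, e']
      ring⟩

lemma IsFrame.expand (F : IsFrame q x y z) {t : ℕ} {f : MvPolynomial (Fin 3) k}
    (hf : f.IsHomogeneous (t + 1)) :
    ∃ f₁ f₂ : MvPolynomial (Fin 3) k, f₁.IsHomogeneous t ∧ f₂.IsHomogeneous t ∧
      f = C (eval q f) * x ^ (t + 1) + y * f₁ + z * f₂ := by
  induction t generalizing f with
  | zero =>
    obtain ⟨f₀, f₁, f₂, h₀, h₁, h₂, e⟩ := F.decompose hf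
    refine ⟨f₁, f₂, h₁, h₂, ?_⟩
    obtain ⟨c, rfl⟩ : ∃ c, f₀ = C c :=
      ⟨_, totalDegree_eq_zero_iff_eq_C.1 (Nat.le_zero.1 h₀.totalDegree_le)⟩
    have : eval q f = c := by rw [e]; simp [F.eval_x, F.eval_y, F.eval_z]
    rw [this, e]
    ring
  | succ t ih =>
    obtain ⟨f₀, f₁, f₂, h₀, h₁, h₂, e⟩ := F.decompose hf
    obtain ⟨r₁, r₂, hr₁, hr₂, e'⟩ := ih h₀
    have : eval q f = eval q f₀ := by rw [e]; simp [F.eval_x, F.eval_y, F.eval_z]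
    refine ⟨x * r₁ + f₁, x * r₂ + f₂, ?_, ?_, ?_⟩
    · exact IsHomogeneous.add (by simpa [add_comm] using F.x_hom.mul hr₁) h₁
    · exact IsHomogeneous.add (by simpa [add_comm] using F.x_hom.mul hr₂) h₂
    · rw [this]
      conv_lhs => rw [e, e']
      ring

lemma IsFrame.exists_of_eval_eq_zero (F : IsFrame q x y z) {t : ℕ} {f : MvPolynomial (Fin 3) k}
    (hf : f.IsHomogeneous (t + 1)) (h : eval q f = 0) :
    ∃ f₁ f₂ : MvPolynomial (Fin 3) k, f₁.IsHomogeneous t ∧ f₂.IsHomogeneous t ∧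
      f = y * f₁ + z * f₂ := by
  obtain ⟨f₁, f₂, h₁, h₂, e⟩ := F.expand hf
  exact ⟨f₁, f₂, h₁, h₂, by simpa [h] using e⟩

lemma eq_zero_of_isHomogeneous_zero_of_eval {f : MvPolynomial (Fin 3) k}
    (hf : f.IsHomogeneous 0) (h : eval q f = 0) : f = 0 := by
  obtain ⟨c, rfl⟩ : ∃ c, f = C c :=
    ⟨_, totalDegree_eq_zero_iff_eq_C.1 (Nat.le_zero.1 hf.totalDegree_le)⟩
  simpa using h

lemma IsFrame.exists_of_mem_shiftPiece (F : IsFrame q x y z) {d b : ℕ}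
    {f : MvPolynomial (Fin 3) k} (hf : f ∈ shiftPiece (Fin 3) k d b) (h : eval q f = 0) :
    ∃ f₁ f₂ : MvPolynomial (Fin 3) k, f = y * f₁ + z * f₂ := by
  have hf' := isHomogeneous_of_mem_shiftPiece hf
  rcases Nat.eq_zero_or_pos (d - b) with h0 | h0
  · rw [h0] at hf'
    exact ⟨0, 0, by simp [eq_zero_of_isHomogeneous_zero_of_eval hf' h]⟩
  · rw [← Nat.sub_add_cancel h0] at hf'
    obtain ⟨f₁, f₂, -, -, e⟩ := F.exists_of_eval_eq_zero hf' h
    exact ⟨f₁, f₂, e⟩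

end Frame

section Syzygies

variable {k : Type*} [Field k] {q : Fin 3 → k} {x y z : MvPolynomial (Fin 3) k}

/-- Homogeneous syzygies `κ j` whose classes modulo `(y, z)` are the powers of `x` times the
standard basis vectors generate the syzygy module, as soon as the coefficients modulo `(y, z)` of
any homogeneous syzygy are divisible by these powers of `x`. -/
lemma IsFrame.mem_span_of_homogeneous (F : IsFrame q x y z) {I : Ideal (MvPolynomial (Fin 3) k)}
    (hz : ∀ f, z * f ∈ I → f ∈ I) {J : Type*} [Fintype J] [DecidableEq J]
    {b : Option J → ℕ} {a : J → ℕ} {g : Option J → MvPolynomial (Fin 3) k}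
    {κ : J → Option J → MvPolynomial (Fin 3) k}
    (hg : ∀ i, (g i).IsHomogeneous (b i)) (hspan : Ideal.span (Set.range g) = I)
    (hκ : ∀ j i, κ j i ∈ shiftPiece (Fin 3) k (a j) (b i))
    (hrel : ∀ j, ∑ i, κ j i * g i = 0)
    (hδ : ∀ j i, eval q (κ j (some i)) = if i = j then 1 else 0)
    (h0 : eval q (g none) ≠ 0)
    (hmin : ∀ (d : ℕ) (v : Option J → MvPolynomial (Fin 3) k),
      (∀ i, v i ∈ shiftPiece (Fin 3) k d (b i)) → ∑ i, v i * g i = 0 →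
      ∀ j, d < a j → eval q (v (some j)) = 0)
    (d : ℕ) (v : Option J → MvPolynomial (Fin 3) k)
    (hv : ∀ i, v i ∈ shiftPiece (Fin 3) k d (b i)) (hv0 : ∑ i, v i * g i = 0) :
    v ∈ Submodule.span (MvPolynomial (Fin 3) k) (Set.range κ) := by
  induction d generalizing v with
  | zero =>
    obtain ⟨v', hv', hv'0, hvv', hev⟩ := reduce 0 v hv hv0
    have : v' = 0 := by
      funext i
      refine eq_zero_of_isHomogeneous_zero_of_eval (q := q) ?_ (hev i)
      simpa using isHomogeneous_of_mem_shiftPiece (hv' i)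
    simpa [this] using hvv'
  | succ d ih =>
    obtain ⟨v', hv', hv'0, hvv', hev⟩ := reduce (d + 1) v hv hv0
    refine (Submodule.sub_mem_iff_left _ ?_).1 hvv'
    choose α β hαβ using fun i => F.exists_of_mem_shiftPiece (hv' i) (hev i)
    obtain ⟨c, hc, hc'⟩ := F.exact (∑ i, α i * g i) (∑ i, β i * g i) (by
      rw [← hv'0, Finset.mul_sum, Finset.mul_sum, ← Finset.sum_add_distrib]
      exact Finset.sum_congr rfl fun i _ => by rw [hαβ]; ring)
    have hcI : c ∈ I := hz c (hc ▸ Ideal.sum_mem _ fun i _ => Ideal.mul_mem_left _ _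
      (hspan ▸ Ideal.subset_span ⟨i, rfl⟩))
    rw [← hspan] at hcI
    obtain ⟨γ, hγ⟩ := (Submodule.mem_span_range_iff_exists_fun _).1 hcI
    simp only [smul_eq_mul] at hγ
    have key : ∀ w : Option J → MvPolynomial (Fin 3) k, ∑ i, w i * g i = 0 →
        (fun i => shiftComponent d (b i) (w i)) ∈
          Submodule.span (MvPolynomial (Fin 3) k) (Set.range κ) := fun w hw => by
      refine ih _ (fun i => shiftComponent_mem _ _ _) ?_
      simp only [shiftComponent_mul_right (hg _)]
      rw [← map_sum, hw, map_zero]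
    have hA := key (fun i => α i - z * γ i) (by
      simp only [sub_mul, Finset.sum_sub_distrib, mul_assoc, ← Finset.mul_sum, hγ, hc, sub_self])
    have hB := key (fun i => β i + y * γ i) (by
      simp only [add_mul, Finset.sum_add_distrib, mul_assoc, ← Finset.mul_sum, hγ, hc',
        neg_add_cancel])
    have : v' = y • (fun i => shiftComponent d (b i) (α i - z * γ i)) +
        z • (fun i => shiftComponent d (b i) (β i + y * γ i)) := by
      funext i
      rw [← shiftComponent_eq_self (hv' i), hαβ]
      simp only [Pi.add_apply, Pi.smul_apply, smul_eq_mul]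
      rw [← shiftComponent_linear_mul F.y_hom, ← shiftComponent_linear_mul F.z_hom, ← map_add]
      congr 1
      ring
    rw [this]
    exact add_mem (Submodule.smul_mem _ _ hA) (Submodule.smul_mem _ _ hB)
where
  reduce (d : ℕ) (v : Option J → MvPolynomial (Fin 3) k)
      (hv : ∀ i, v i ∈ shiftPiece (Fin 3) k d (b i)) (hv0 : ∑ i, v i * g i = 0) :
      ∃ v' : Option J → MvPolynomial (Fin 3) k, (∀ i, v' i ∈ shiftPiece (Fin 3) k d (b i)) ∧
        ∑ i, v' i * g i = 0 ∧
        v - v' ∈ Submodule.span (MvPolynomial (Fin 3) k) (Set.range κ) ∧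
        ∀ i, eval q (v' i) = 0 := by
    let w : J → MvPolynomial (Fin 3) k := fun j =>
      if a j ≤ d then C (eval q (v (some j))) * x ^ (d - a j) else 0
    have hw : ∀ j, eval q (w j) = eval q (v (some j)) := fun j => by
      by_cases h : a j ≤ d
      · simp [w, h, F.eval_x]
      · simp [w, h, hmin d v hv hv0 j (not_le.1 h)]
    have hs0 : ∑ i, (v i - ∑ j, w j * κ j i) * g i = 0 := by
      simp only [sub_mul, Finset.sum_sub_distrib, hv0, zero_sub, neg_eq_zero, Finset.sum_mul]
      rw [Finset.sum_comm]
      refine Finset.sum_eq_zero fun j _ => ?_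
      simp only [mul_assoc, ← Finset.mul_sum, hrel, mul_zero]
    have hsome : ∀ i, eval q (v (some i) - ∑ j, w j * κ j (some i)) = 0 := fun i => by
      simp [hδ, hw]
    refine ⟨fun i => v i - ∑ j, w j * κ j i, fun i => ?_, hs0, ?_, ?_⟩
    · refine sub_mem (hv i) (Submodule.sum_mem _ fun j _ => ?_)
      by_cases h : a j ≤ d
      · have := mul_mem_shiftPiece (c := d - a j) (l := w j) (by
          simp only [w, if_pos h]
          simpa using (F.x_hom.pow (d - a j)).C_mul _) (hκ j i)
        rwa [Nat.sub_add_cancel h] at this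
      · simp [w, h]
    · have : (v - fun i => v i - ∑ j, w j * κ j i) = ∑ j, w j • κ j := by
        funext i
        simp
      rw [this]
      exact Submodule.sum_mem _ fun j _ => Submodule.smul_mem _ _ (Submodule.subset_span ⟨j, rfl⟩)
    · rintro (_ | i)
      · have := congrArg (eval q) hs0
        have hrest : ∑ i, eval q ((v (some i) - ∑ j, w j * κ j (some i)) * g (some i)) = 0 :=
          Finset.sum_eq_zero fun i _ => by rw [map_mul, hsome, zero_mul]
        rw [Fintype.sum_option, map_add, map_mul, map_sum, hrest, map_zero, add_zero] at this
        exact (mul_eq_zero.1 this).resolve_right h0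
      · exact hsome i

lemma hasRegularity_of_syzygies {σ A : Type*} [CommRing A] {I : Ideal (MvPolynomial σ A)}
    {ι J : Type*} [Fintype ι] [Fintype J] {b : ι → ℕ} {a : J → ℕ}
    {g : ι → MvPolynomial σ A} {κ : J → ι → MvPolynomial σ A}
    (hg : ∀ i, (g i).IsHomogeneous (b i)) (hspan : Ideal.span (Set.range g) = I)
    (hκ : ∀ j i, (κ j i).IsHomogeneous (a j - b i))
    (hκ0 : ∀ j i, a j ≤ b i → κ j i = 0)
    (hrel : ∀ j, ∑ i, κ j i * g i = 0)
    (hli : LinearIndependent (MvPolynomial σ A) κ)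
    (hgen : ∀ v : ι → MvPolynomial σ A, ∑ i, v i * g i = 0 →
      v ∈ Submodule.span (MvPolynomial σ A) (Set.range κ))
    {r : ℕ} (hb : ∀ i, b i ≤ r) (ha : ∀ j, a j ≤ r + 1)
    (hr : (∃ i, b i = r) ∨ ∃ j, a j = r + 1) : HasRegularity I r := by
  let e := Fintype.equivFin ι
  let e' := Fintype.equivFin J
  have hrow : ∀ v, rowMap (g ∘ e.symm) v = ∑ i, v (e i) * g i := fun v => by
    rw [rowMap, LinearMap.sum_apply, ← e.sum_comp]
    simp [mul_comm]
  have hmul : ∀ w : Fin (Fintype.card J) → MvPolynomial σ A,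
      (Matrix.of fun i j => κ (e'.symm j) (e.symm i)).mulVecLin w =
        (∑ j, w (e' j) • κ j) ∘ e.symm := fun w => by
    funext i
    rw [mulVecLin_apply, mulVec, dotProduct, ← e'.sum_comp]
    simp [mul_comm]
  refine ⟨_, _, b ∘ e.symm, a ∘ e'.symm, ⟨g ∘ e.symm,
    Matrix.of fun i j => κ (e'.symm j) (e.symm i), fun i => hg _, ?_, fun i j => ⟨hκ _ _, hκ0 _ _⟩,
    ?_, ?_⟩, ?_⟩
  · rw [e.symm.surjective.range_comp, hspan]
  · rw [← LinearMap.ker_eq_bot, LinearMap.ker_eq_bot']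
    intro w hw
    rw [hmul] at hw
    have hw' : ∑ j, w (e' j) • κ j = 0 := by
      funext i
      simpa using congrFun hw (e i)
    funext j
    simpa using Fintype.linearIndependent_iff.1 hli (fun j => w (e' j)) hw' (e'.symm j)
  · ext v
    rw [LinearMap.mem_range, LinearMap.mem_ker, hrow]
    constructor
    · rintro ⟨w, rfl⟩
      rw [hmul]
      simp only [Function.comp_apply, Equiv.symm_apply_apply, Finset.sum_apply, Finset.sum_mul]
      rw [Finset.sum_comm]
      refine Finset.sum_eq_zero fun j _ => ?_
      simp only [Pi.smul_apply, smul_eq_mul, mul_assoc, ← Finset.mul_sum, hrel, mul_zero]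
    · intro hv
      obtain ⟨c, hc⟩ := (Submodule.mem_span_range_iff_exists_fun _).1 (hgen _ hv)
      refine ⟨c ∘ e'.symm, ?_⟩
      rw [hmul]
      funext i
      simpa using congrFun hc (e.symm i)
  · have h1 : Finset.univ.sup (b ∘ e.symm) ≤ r := Finset.sup_le fun i _ => hb _
    have h2 : Finset.univ.sup (a ∘ e'.symm) ≤ r + 1 := Finset.sup_le fun i _ => ha _
    refine le_antisymm (sup_le h1 (by omega)) ?_
    rcases hr with ⟨i, hi⟩ | ⟨j, hj⟩
    · have := Finset.le_sup (f := b ∘ e.symm) (Finset.mem_univ (e i))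
      simp only [Function.comp_apply, Equiv.symm_apply_apply, hi] at this
      exact le_sup_of_le_left this
    · have := Finset.le_sup (f := a ∘ e'.symm) (Finset.mem_univ (e' j))
      simp only [Function.comp_apply, Equiv.symm_apply_apply, hj] at this
      exact le_sup_of_le_right (by omega)

lemma IsFrame.hasRegularity (F : IsFrame q x y z) {I : Ideal (MvPolynomial (Fin 3) k)}
    (hz : ∀ f, z * f ∈ I → f ∈ I) {J : Type*} [Fintype J] [DecidableEq J]
    {b : Option J → ℕ} {a : J → ℕ} {g : Option J → MvPolynomial (Fin 3) k}
    {κ : J → Option J → MvPolynomial (Fin 3) k}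
    (hg : ∀ i, (g i).IsHomogeneous (b i)) (hspan : Ideal.span (Set.range g) = I)
    (hκ : ∀ j i, κ j i ∈ shiftPiece (Fin 3) k (a j) (b i))
    (hrel : ∀ j, ∑ i, κ j i * g i = 0)
    (hδ : ∀ j i, eval q (κ j (some i)) = if i = j then 1 else 0)
    (h0 : eval q (g none) ≠ 0)
    (hmin : ∀ (d : ℕ) (v : Option J → MvPolynomial (Fin 3) k),
      (∀ i, v i ∈ shiftPiece (Fin 3) k d (b i)) → ∑ i, v i * g i = 0 →
      ∀ j, d < a j → eval q (v (some j)) = 0)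
    (hnone : ∀ j, b none < a j) (hlt : ∀ j, b (some j) < a j)
    {r : ℕ} (hb : ∀ i, b i ≤ r) (ha : ∀ j, a j ≤ r + 1)
    (hr : (∃ i, b i = r) ∨ ∃ j, a j = r + 1) : HasRegularity I r := by
  refine hasRegularity_of_syzygies hg hspan (fun j i => isHomogeneous_of_mem_shiftPiece (hκ j i))
    ?_ hrel ?_ ?_ hb ha hr
  · intro j i hij
    rcases hij.lt_or_eq with h | h
    · exact eq_zero_of_mem_shiftPiece h (hκ j i)
    · rcases i with _ | i
      · exact absurd (hnone j) (by omega)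
      · have hne : i ≠ j := by
          rintro rfl
          exact absurd (hlt i) (by omega)
        refine eq_zero_of_isHomogeneous_zero_of_eval (q := q) ?_ (by rw [hδ, if_neg hne])
        simpa [h] using isHomogeneous_of_mem_shiftPiece (hκ j (some i))
  · rw [Fintype.linearIndependent_iff]
    intro w hw
    let N : Matrix J J (MvPolynomial (Fin 3) k) := Matrix.of fun j i => κ j (some i)
    have hdet : N.det ≠ 0 := by
      intro h
      have := congrArg (eval q) h
      rw [RingHom.map_det, map_zero] at this
      have h1 : (eval q).mapMatrix N = 1 := by
        ext j i
        simp [N, hδ, Matrix.one_apply, eq_comm]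
      rw [h1, det_one] at this
      exact one_ne_zero this
    refine congrFun (Matrix.eq_zero_of_vecMul_eq_zero hdet ?_)
    funext i
    simpa [vecMul, dotProduct, N] using congrFun hw (some i)
  · intro v hv
    obtain ⟨D, hD⟩ := exists_sum_shiftComponent b v
    have : v = ∑ d ∈ Finset.range D, fun i => shiftComponent d (b i) (v i) := by
      funext i
      rw [Finset.sum_apply]
      exact hD i
    rw [this]
    refine Submodule.sum_mem _ fun d _ => F.mem_span_of_homogeneous hz hg hspan hκ hrel hδ h0 hmin d
      _ (fun i => shiftComponent_mem _ _ _) ?_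
    simp only [shiftComponent_mul_right (hg _)]
    rw [← map_sum, hv, map_zero]

end Syzygies

section Generators

variable {k : Type*} [Field k] {q : Fin 3 → k} {x y z : MvPolynomial (Fin 3) k}

lemma mem_gradedPiece {I : Ideal (MvPolynomial (Fin 3) k)} {t : ℕ} {f : MvPolynomial (Fin 3) k} :
    f ∈ gradedPiece I t ↔ f ∈ I ∧ f.IsHomogeneous t := Iff.rfl

instance (I : Ideal (MvPolynomial (Fin 3) k)) (t : ℕ) : Module.Finite k (gradedPiece I t) :=
  have : Module.Finite k (homogeneousSubmodule (Fin 3) k t) :=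
    Module.Finite.iff_fg.2 (homogeneousSubmodule_fg (Fin 3) k t)
  Submodule.finiteDimensional_of_le inf_le_right

/-- Representatives of a basis of `(A + B) / A`. -/
lemma exists_basis_modulo {M : Type*} [AddCommGroup M] [Module k M] (A B : Submodule k M)
    (hAB : A ≤ B) [Module.Finite k B] :
    ∃ (n : ℕ) (u : Fin n → M), (∀ i, u i ∈ B) ∧
      (∀ f ∈ B, ∃ c : Fin n → k, f - ∑ i, c i • u i ∈ A) ∧
      ∀ c : Fin n → k, ∑ i, c i • u i ∈ A → c = 0 := by
  obtain ⟨D, hD⟩ := Submodule.exists_isCompl A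
  have : Module.Finite k (D ⊓ B : Submodule k M) := Submodule.finiteDimensional_of_le inf_le_right
  let β := Module.finBasis k (D ⊓ B : Submodule k M)
  refine ⟨_, fun i => β i, fun i => (β i).2.2, fun f hf => ?_, fun c hc => ?_⟩
  · obtain ⟨a, ha, d, hd, rfl⟩ := Submodule.mem_sup.1 (hD.sup_eq_top ▸ Submodule.mem_top (x := f))
    have hdB : d ∈ B := by simpa using sub_mem hf (hAB ha)
    refine ⟨β.repr ⟨d, hd, hdB⟩, ?_⟩
    have := congrArg Subtype.val (β.sum_repr ⟨d, hd, hdB⟩)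
    simp only [Submodule.coe_sum, Submodule.coe_smul] at this
    rwa [this, add_sub_cancel_right]
  · have h0 : ∑ i, c i • β i = 0 := by
      have hDm : (∑ i, c i • (β i : M)) ∈ D :=
        Submodule.sum_mem _ fun i _ => Submodule.smul_mem _ _ (β i).2.1
      have := Submodule.disjoint_def.1 hD.disjoint _ hc hDm
      apply Subtype.ext
      simpa only [Submodule.coe_sum, Submodule.coe_smul, ZeroMemClass.coe_zero] using this
    exact funext (Fintype.linearIndependent_iff.1 β.linearIndependent c h0)

/-- The sum `y V + z V`. -/
noncomputable def pairMul (y z : MvPolynomial (Fin 3) k) (V : Submodule k (MvPolynomial (Fin 3) k)) :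
    Submodule k (MvPolynomial (Fin 3) k) :=
  V.map (LinearMap.mulLeft k y) ⊔ V.map (LinearMap.mulLeft k z)

lemma mem_pairMul {V : Submodule k (MvPolynomial (Fin 3) k)} {f : MvPolynomial (Fin 3) k} :
    f ∈ pairMul y z V ↔ ∃ f₁ ∈ V, ∃ f₂ ∈ V, f = y * f₁ + z * f₂ := by
  simp [pairMul, Submodule.mem_sup, eq_comm]

/-- The sum `x V + y V + z V`. -/
noncomputable def tripleMul (x y z : MvPolynomial (Fin 3) k)
    (V : Submodule k (MvPolynomial (Fin 3) k)) : Submodule k (MvPolynomial (Fin 3) k) :=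
  V.map (LinearMap.mulLeft k x) ⊔ pairMul y z V

lemma mem_tripleMul {V : Submodule k (MvPolynomial (Fin 3) k)} {f : MvPolynomial (Fin 3) k} :
    f ∈ tripleMul x y z V ↔ ∃ f₀ ∈ V, ∃ f₁ ∈ V, ∃ f₂ ∈ V, f = x * f₀ + y * f₁ + z * f₂ := by
  simp only [tripleMul, Submodule.mem_sup, Submodule.mem_map, LinearMap.mulLeft_apply, mem_pairMul]
  constructor
  · rintro ⟨_, ⟨f₀, h₀, rfl⟩, _, ⟨f₁, h₁, f₂, h₂, rfl⟩, rfl⟩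
    exact ⟨f₀, h₀, f₁, h₁, f₂, h₂, by ring⟩
  · rintro ⟨f₀, h₀, f₁, h₁, f₂, h₂, rfl⟩
    exact ⟨_, ⟨f₀, h₀, rfl⟩, _, ⟨f₁, h₁, f₂, h₂, rfl⟩, by ring⟩

lemma mul_mem_gradedPiece {I : Ideal (MvPolynomial (Fin 3) k)} {l f : MvPolynomial (Fin 3) k}
    {t : ℕ} (hl : l.IsHomogeneous 1) (hf : f ∈ gradedPiece I t) : l * f ∈ gradedPiece I (t + 1) :=
  ⟨I.mul_mem_left _ hf.1, by simpa [add_comm] using hl.mul hf.2⟩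

lemma IsFrame.linear_mul_mem_tripleMul (F : IsFrame q x y z)
    {V : Submodule k (MvPolynomial (Fin 3) k)} {l f : MvPolynomial (Fin 3) k}
    (hl : l.IsHomogeneous 1) (hf : f ∈ V) : l * f ∈ tripleMul x y z V := by
  obtain ⟨a, b, c, rfl⟩ := Submodule.mem_span_triple.1 (F.mem_span l hl)
  exact mem_tripleMul.2 ⟨a • f, V.smul_mem a hf, b • f, V.smul_mem b hf, c • f, V.smul_mem c hf,
    by simp only [add_mul, smul_mul_assoc, mul_smul_comm]⟩

/-- The forms of degree `m + 1` are spanned by those in `I` and by multiples of `z`. -/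
def FullModulo (I : Ideal (MvPolynomial (Fin 3) k)) (z : MvPolynomial (Fin 3) k) (m : ℕ) : Prop :=
  ∀ f : MvPolynomial (Fin 3) k, f.IsHomogeneous (m + 1) →
    ∃ i ∈ gradedPiece I (m + 1), ∃ r : MvPolynomial (Fin 3) k, r.IsHomogeneous m ∧ f = i + z * r

variable {I : Ideal (MvPolynomial (Fin 3) k)}

lemma IsFrame.fullModulo_succ (F : IsFrame q x y z) {m : ℕ} (H : FullModulo I z m) :
    FullModulo I z (m + 1) := by
  intro f hf
  obtain ⟨f₀, f₁, f₂, h₀, h₁, h₂, rfl⟩ := F.decompose hf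
  obtain ⟨i₀, hi₀, r₀, hr₀, rfl⟩ := H f₀ h₀
  obtain ⟨i₁, hi₁, r₁, hr₁, rfl⟩ := H f₁ h₁
  refine ⟨x * i₀ + y * i₁, add_mem (mul_mem_gradedPiece F.x_hom hi₀)
    (mul_mem_gradedPiece F.y_hom hi₁), x * r₀ + y * r₁ + f₂, ?_, by ring⟩
  refine IsHomogeneous.add (IsHomogeneous.add ?_ ?_) h₂
  · simpa [add_comm] using F.x_hom.mul hr₀
  · simpa [add_comm] using F.y_hom.mul hr₁

lemma IsFrame.gradedPiece_le_tripleMul (F : IsFrame q x y z) (hz : ∀ f, z * f ∈ I → f ∈ I) {m : ℕ}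
    (H : FullModulo I z m) :
    gradedPiece I (m + 1 + 1) ≤ tripleMul x y z (gradedPiece I (m + 1)) := by
  intro f hf
  obtain ⟨hfI, hf⟩ := mem_gradedPiece.1 hf
  obtain ⟨f₀, f₁, f₂, h₀, h₁, h₂, rfl⟩ := F.decompose hf
  obtain ⟨i₀, hi₀, r₀, hr₀, rfl⟩ := H f₀ h₀
  obtain ⟨i₁, hi₁, r₁, hr₁, rfl⟩ := H f₁ h₁
  have hmem : x * r₀ + y * r₁ + f₂ ∈ I := by
    refine hz _ ?_
    have := sub_mem hfI (add_mem (I.mul_mem_left x hi₀.1) (I.mul_mem_left y hi₁.1))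
    convert this using 1
    ring
  refine mem_tripleMul.2 ⟨i₀, hi₀, i₁, hi₁, x * r₀ + y * r₁ + f₂, ⟨hmem, ?_⟩, by ring⟩
  refine IsHomogeneous.add (IsHomogeneous.add ?_ ?_) h₂
  · simpa [add_comm] using F.x_hom.mul hr₀
  · simpa [add_comm] using F.y_hom.mul hr₁

lemma IsFrame.pow_mul_mem_pairMul (F : IsFrame q x y z) (hz : ∀ f, z * f ∈ I → f ∈ I) {m t e : ℕ}
    (H : FullModulo I z m) {f : MvPolynomial (Fin 3) k} (hf : f ∈ gradedPiece I (t + 1))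
    (h : eval q f = 0) (hte : t + e = m + 1) :
    x ^ e * f ∈ pairMul y z (gradedPiece I (m + 1)) := by
  obtain ⟨f₁, f₂, h₁, h₂, rfl⟩ := F.exists_of_eval_eq_zero hf.2 h
  have hx : ∀ g : MvPolynomial (Fin 3) k, g.IsHomogeneous t → (x ^ e * g).IsHomogeneous (m + 1) :=
    fun g hg => by simpa [← hte, add_comm] using (F.x_hom.pow e).mul hg
  obtain ⟨i, hi, r, hr, hir⟩ := H _ (hx f₁ h₁)
  have e₁ : x ^ e * (y * f₁ + z * f₂) = y * i + z * (y * r + x ^ e * f₂) := by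
    linear_combination y * hir
  have hmem : y * r + x ^ e * f₂ ∈ I := by
    refine hz _ ?_
    have := sub_mem (I.mul_mem_left (x ^ e) hf.1) (I.mul_mem_left y hi.1)
    rw [e₁] at this
    simpa using this
  refine mem_pairMul.2 ⟨i, hi, _, ⟨hmem, ?_⟩, e₁⟩
  exact IsHomogeneous.add (by simpa [add_comm] using F.y_hom.mul hr) (hx f₂ h₂)

/-- The homogeneous combinations of degree `d` of elements `g i` of degree `b i`. -/
noncomputable def combinations {ι : Type*} [Fintype ι] (b : ι → ℕ)
    (g : ι → MvPolynomial (Fin 3) k) (d : ℕ) : Submodule k (MvPolynomial (Fin 3) k) where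
  carrier := {f | ∃ c : ι → MvPolynomial (Fin 3) k,
    (∀ i, c i ∈ shiftPiece (Fin 3) k d (b i)) ∧ f = ∑ i, c i * g i}
  zero_mem' := ⟨0, fun _ => zero_mem _, by simp⟩
  add_mem' := by
    rintro _ _ ⟨c, hc, rfl⟩ ⟨c', hc', rfl⟩
    exact ⟨c + c', fun i => add_mem (hc i) (hc' i), by simp [add_mul, Finset.sum_add_distrib]⟩
  smul_mem' := by
    rintro a _ ⟨c, hc, rfl⟩
    exact ⟨a • c, fun i => Submodule.smul_mem _ a (hc i), by simp [Finset.smul_sum]⟩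

lemma mem_combinations_self {ι : Type*} [Fintype ι] (b : ι → ℕ) (g : ι → MvPolynomial (Fin 3) k)
    (i : ι) : g i ∈ combinations b g (b i) := by
  classical
  refine ⟨Pi.single i 1, fun j => ?_, ?_⟩
  · rcases eq_or_ne j i with rfl | h
    · simpa using (mem_shiftPiece_add (e := 0)).2 (isHomogeneous_one (Fin 3) k)
    · simp [h]
  · rw [Finset.sum_eq_single i (fun j _ h => by simp [h]) (fun h => absurd (Finset.mem_univ i) h)]
    simp

lemma mul_mem_combinations {ι : Type*} [Fintype ι] {b : ι → ℕ} {g : ι → MvPolynomial (Fin 3) k}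
    {d : ℕ} {l f : MvPolynomial (Fin 3) k} (hl : l.IsHomogeneous 1)
    (hf : f ∈ combinations b g d) : l * f ∈ combinations b g (d + 1) := by
  obtain ⟨c, hc, rfl⟩ := hf
  refine ⟨fun i => l * c i, fun i => ?_, by simp [Finset.mul_sum, mul_assoc]⟩
  rw [add_comm d]
  exact mul_mem_shiftPiece hl (hc i)

lemma combinations_le_span {ι : Type*} [Fintype ι] {b : ι → ℕ} {g : ι → MvPolynomial (Fin 3) k}
    {d : ℕ} {f : MvPolynomial (Fin 3) k} (hf : f ∈ combinations b g d) :
    f ∈ Ideal.span (Set.range g) := by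
  obtain ⟨c, -, rfl⟩ := hf
  exact Ideal.sum_mem _ fun i _ => Ideal.mul_mem_left _ _ (Ideal.subset_span ⟨i, rfl⟩)

lemma IsFrame.tripleMul_le_combinations (F : IsFrame q x y z) {ι : Type*} [Fintype ι] {b : ι → ℕ}
    {g : ι → MvPolynomial (Fin 3) k} {d : ℕ} {V : Submodule k (MvPolynomial (Fin 3) k)}
    (hV : V ≤ combinations b g d) : tripleMul x y z V ≤ combinations b g (d + 1) := by
  intro f hf
  obtain ⟨f₀, h₀, f₁, h₁, f₂, h₂, rfl⟩ := mem_tripleMul.1 hf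
  exact add_mem (add_mem (mul_mem_combinations F.x_hom (hV h₀))
    (mul_mem_combinations F.y_hom (hV h₁))) (mul_mem_combinations F.z_hom (hV h₂))

lemma IsFrame.exists_syzygies (F : IsFrame q x y z) {J : Type*} [Fintype J] [DecidableEq J]
    {b : Option J → ℕ} {a : J → ℕ} {g : Option J → MvPolynomial (Fin 3) k}
    (h : ∀ j, ∃ d e, a j = d + 1 ∧ a j = e + b (some j) ∧
      x ^ e * g (some j) ∈ pairMul y z (combinations b g d)) :
    ∃ κ : J → Option J → MvPolynomial (Fin 3) k,
      (∀ j i, κ j i ∈ shiftPiece (Fin 3) k (a j) (b i)) ∧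
      (∀ j, ∑ i, κ j i * g i = 0) ∧
      ∀ j i, eval q (κ j (some i)) = if i = j then 1 else 0 := by
  suffices H : ∀ j, ∃ v : Option J → MvPolynomial (Fin 3) k,
      (∀ i, v i ∈ shiftPiece (Fin 3) k (a j) (b i)) ∧ ∑ i, v i * g i = 0 ∧
      ∀ i, eval q (v (some i)) = if i = j then 1 else 0 by
    choose κ h₁ h₂ h₃ using H
    exact ⟨κ, h₁, h₂, h₃⟩
  intro j
  obtain ⟨d, e, hd, he, hm⟩ := h j
  obtain ⟨_, ⟨c, hc, rfl⟩, _, ⟨c', hc', rfl⟩, hxe⟩ := mem_pairMul.1 hm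
  refine ⟨fun i => (if i = some j then x ^ e else 0) - (y * c i + z * c' i), fun i => ?_, ?_,
    fun i => ?_⟩
  · refine sub_mem ?_ (add_mem ?_ ?_)
    · split_ifs with hi
      · rw [hi, he, add_comm, mem_shiftPiece_add]
        simpa using F.x_hom.pow e
      · exact zero_mem _
    · rw [hd, add_comm d]
      exact mul_mem_shiftPiece F.y_hom (hc i)
    · rw [hd, add_comm d]
      exact mul_mem_shiftPiece F.z_hom (hc' i)
  · simp only [sub_mul, add_mul, ite_mul, zero_mul, Finset.sum_sub_distrib, Finset.sum_add_distrib,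
      mul_assoc, ← Finset.mul_sum, Finset.sum_ite_eq', Finset.mem_univ, if_true]
    rw [hxe, sub_self]
  · simp only [map_sub, map_add, map_mul, F.eval_y, F.eval_z, zero_mul, add_zero, sub_zero,
      Option.some_inj]
    split_ifs <;> simp [F.eval_x]

end Generators

section Construction

variable {k : Type*} [Field k] {q : Fin 3 → k} {x y z : MvPolynomial (Fin 3) k}
  {I : Ideal (MvPolynomial (Fin 3) k)}

/-- The forms of degree `t` in `I` vanishing at `q`. -/
noncomputable def vanishingPiece (I : Ideal (MvPolynomial (Fin 3) k)) (q : Fin 3 → k) (t : ℕ) :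
    Submodule k (MvPolynomial (Fin 3) k) :=
  gradedPiece I t ⊓ LinearMap.ker (MvPolynomial.aeval q : MvPolynomial (Fin 3) k →ₐ[k] k).toLinearMap

lemma mem_vanishingPiece {t : ℕ} {f : MvPolynomial (Fin 3) k} :
    f ∈ vanishingPiece I q t ↔ f ∈ gradedPiece I t ∧ eval q f = 0 := by
  simp [vanishingPiece, aeval_eq_eval]

instance (I : Ideal (MvPolynomial (Fin 3) k)) (q : Fin 3 → k) (t : ℕ) :
    Module.Finite k (vanishingPiece I q t) :=
  Submodule.finiteDimensional_of_le inf_le_left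

/-- Initial generators: `w` spans those forms `f` of degree `s` vanishing at `q` with
`x f ∈ y I_s + z I_s`, `u` completes `w` to a basis of the forms of degree `s` vanishing at `q`,
and `p` is a minimal set of generators of degree `s + 1`. -/
structure IsAdapted (I : Ideal (MvPolynomial (Fin 3) k)) (q : Fin 3 → k)
    (x y z : MvPolynomial (Fin 3) k) (s : ℕ) {nw nu np : ℕ} (w : Fin nw → MvPolynomial (Fin 3) k)
    (u : Fin nu → MvPolynomial (Fin 3) k) (p : Fin np → MvPolynomial (Fin 3) k) : Prop where
  w_mem : ∀ i, w i ∈ vanishingPiece I q s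
  x_mul_w_mem : ∀ i, x * w i ∈ pairMul y z (gradedPiece I s)
  w_indep : ∀ c : Fin nw → k, ∑ i, c i • w i = 0 → c = 0
  u_mem : ∀ i, u i ∈ vanishingPiece I q s
  u_span : ∀ f ∈ vanishingPiece I q s, ∃ (c : Fin nw → k) (c' : Fin nu → k),
    f = ∑ i, c i • w i + ∑ i, c' i • u i
  u_indep : ∀ c : Fin nu → k, x * ∑ i, c i • u i ∈ pairMul y z (gradedPiece I s) → c = 0
  p_mem : ∀ i, p i ∈ vanishingPiece I q (s + 1)
  p_span : ∀ f ∈ vanishingPiece I q (s + 1), ∃ c : Fin np → k,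
    f - ∑ i, c i • p i ∈ tripleMul x y z (gradedPiece I s)
  p_indep : ∀ c : Fin np → k, ∑ i, c i • p i ∈ tripleMul x y z (gradedPiece I s) → c = 0

lemma exists_isAdapted (I : Ideal (MvPolynomial (Fin 3) k)) (q : Fin 3 → k)
    (x y z : MvPolynomial (Fin 3) k) (s : ℕ) :
    ∃ (nw nu np : ℕ) (w : Fin nw → MvPolynomial (Fin 3) k)
      (u : Fin nu → MvPolynomial (Fin 3) k) (p : Fin np → MvPolynomial (Fin 3) k),
      IsAdapted I q x y z s w u p := by
  let W : Submodule k (MvPolynomial (Fin 3) k) := vanishingPiece I q s ⊓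
    (pairMul y z (gradedPiece I s)).comap (LinearMap.mulLeft k x)
  have hWV : W ≤ vanishingPiece I q s := inf_le_left
  have : Module.Finite k W := Submodule.finiteDimensional_of_le hWV
  obtain ⟨nw, w, hw, hws, hwi⟩ := exists_basis_modulo ⊥ W bot_le
  obtain ⟨nu, u, hu, hus, hui⟩ := exists_basis_modulo W (vanishingPiece I q s) hWV
  obtain ⟨np, p, hp, hps, hpi⟩ := exists_basis_modulo
    (vanishingPiece I q (s + 1) ⊓ tripleMul x y z (gradedPiece I s)) (vanishingPiece I q (s + 1))
    inf_le_left
  refine ⟨nw, nu, np, w, u, p, fun i => hWV (hw i), fun i => (hw i).2, fun c hc => hwi c hc,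
    hu, fun f hf => ?_, fun c hc => hui c ⟨?_, hc⟩, hp, fun f hf => ?_, fun c hc => hpi c ⟨?_, hc⟩⟩
  · obtain ⟨c', hc'⟩ := hus f hf
    obtain ⟨c, hc⟩ := hws _ hc'
    exact ⟨c, c', by rw [← sub_eq_zero, ← (Submodule.mem_bot k).1 hc]; abel⟩
  · exact Submodule.sum_mem _ fun i _ => Submodule.smul_mem _ _ (hu i)
  · obtain ⟨c, hc⟩ := hps f hf
    exact ⟨c, hc.2⟩
  · exact Submodule.sum_mem _ fun i _ => Submodule.smul_mem _ _ (hp i)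

section Adapted

variable {s nw nu np : ℕ} {g₀ : MvPolynomial (Fin 3) k} {w : Fin nw → MvPolynomial (Fin 3) k}
  {u : Fin nu → MvPolynomial (Fin 3) k} {p : Fin np → MvPolynomial (Fin 3) k}

/-- The family of generators. -/
def generators (g₀ : MvPolynomial (Fin 3) k) (w : Fin nw → MvPolynomial (Fin 3) k)
    (u : Fin nu → MvPolynomial (Fin 3) k) (p : Fin np → MvPolynomial (Fin 3) k) :
    Option (Fin nw ⊕ Fin nu ⊕ Fin np) → MvPolynomial (Fin 3) k
  | none => g₀
  | some (.inl i) => w i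
  | some (.inr (.inl i)) => u i
  | some (.inr (.inr i)) => p i

/-- The degrees of the generators. -/
def generatorDegrees (s nw nu np : ℕ) : Option (Fin nw ⊕ Fin nu ⊕ Fin np) → ℕ
  | none => s
  | some (.inl _) => s
  | some (.inr (.inl _)) => s
  | some (.inr (.inr _)) => s + 1

/-- The degrees of the syzygies. -/
def syzygyDegrees (s nw nu np : ℕ) : Fin nw ⊕ Fin nu ⊕ Fin np → ℕ
  | .inl _ => s + 1
  | .inr _ => s + 2

lemma sub_smul_mem_vanishingPiece {t : ℕ} {f e : MvPolynomial (Fin 3) k}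
    (hf : f ∈ gradedPiece I t) (he : e ∈ gradedPiece I t) (h0 : eval q e ≠ 0) :
    f - (eval q f / eval q e) • e ∈ vanishingPiece I q t := by
  refine mem_vanishingPiece.2 ⟨sub_mem hf (Submodule.smul_mem _ _ he), ?_⟩
  rw [map_sub, smul_eval, div_mul_cancel₀ _ h0, sub_self]

namespace IsAdapted

variable (F : IsFrame q x y z) (A : IsAdapted I q x y z s w u p) (hg₀ : g₀ ∈ gradedPiece I s)
  (h₀ : eval q g₀ ≠ 0)

include A hg₀

lemma generators_mem (i : Option (Fin nw ⊕ Fin nu ⊕ Fin np)) :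
    generators g₀ w u p i ∈ gradedPiece I (generatorDegrees s nw nu np i) := by
  rcases i with _ | i | i | i
  · exact hg₀
  · exact (A.w_mem i).1
  · exact (A.u_mem i).1
  · exact (A.p_mem i).1

include h₀

lemma gradedPiece_le_combinations :
    gradedPiece I s ≤ combinations (generatorDegrees s nw nu np) (generators g₀ w u p) s := by
  intro f hf
  have hmem := mem_combinations_self (generatorDegrees s nw nu np) (generators g₀ w u p)
  obtain ⟨c, c', hc⟩ := A.u_span _ (sub_smul_mem_vanishingPiece hf hg₀ h₀)
  rw [sub_eq_iff_eq_add.1 hc]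
  exact add_mem (add_mem
    (Submodule.sum_mem _ fun i _ => Submodule.smul_mem _ _ (hmem (some (.inl i))))
    (Submodule.sum_mem _ fun i _ => Submodule.smul_mem _ _ (hmem (some (.inr (.inl i))))))
    (Submodule.smul_mem _ _ (hmem none))

include F

lemma gradedPiece_succ_le_combinations :
    gradedPiece I (s + 1) ≤
      combinations (generatorDegrees s nw nu np) (generators g₀ w u p) (s + 1) := by
  intro f hf
  have hmem := mem_combinations_self (generatorDegrees s nw nu np) (generators g₀ w u p)
  obtain ⟨c, hc⟩ := A.p_span _ (sub_smul_mem_vanishingPiece hf (mul_mem_gradedPiece F.x_hom hg₀)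
    (by rwa [map_mul, F.eval_x, one_mul]))
  have h1 := F.tripleMul_le_combinations (A.gradedPiece_le_combinations hg₀ h₀) hc
  have h2 : ∑ i, c i • p i ∈ combinations (generatorDegrees s nw nu np) (generators g₀ w u p)
      (s + 1) :=
    Submodule.sum_mem _ fun i _ => Submodule.smul_mem _ _ (hmem (some (.inr (.inr i))))
  have h3 : x * g₀ ∈ combinations (generatorDegrees s nw nu np) (generators g₀ w u p) (s + 1) :=
    mul_mem_combinations F.x_hom (hmem none)
  have := add_mem (add_mem h1 h2) (Submodule.smul_mem _ (eval q f / eval q (x * g₀)) h3)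
  simpa using this

lemma span_generators (hz : ∀ f, z * f ∈ I → f ∈ I)
    (hI : ∀ f ∈ I, ∀ d, homogeneousComponent d f ∈ I) (hlow : ∀ t < s, gradedPiece I t = ⊥)
    (H : FullModulo I z s) : Ideal.span (Set.range (generators g₀ w u p)) = I := by
  have hfull : ∀ t, FullModulo I z (s + t) := fun t => by
    induction t with
    | zero => exact H
    | succ t ih => exact F.fullModulo_succ ih
  have hcomb : ∀ t, gradedPiece I (s + 1 + t) ≤
      combinations (generatorDegrees s nw nu np) (generators g₀ w u p) (s + 1 + t) := fun t => by
    induction t with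
    | zero => exact A.gradedPiece_succ_le_combinations F hg₀ h₀
    | succ t ih =>
      refine le_trans ?_ (F.tripleMul_le_combinations ih)
      have := F.gradedPiece_le_tripleMul hz (hfull t)
      rwa [add_right_comm s t 1] at this
  apply le_antisymm
  · rw [Ideal.span_le]
    rintro _ ⟨i, rfl⟩
    exact (A.generators_mem hg₀ i).1
  · intro f hf
    rw [← sum_homogeneousComponent f]
    refine Ideal.sum_mem _ fun d _ => ?_
    have hd : homogeneousComponent d f ∈ gradedPiece I d :=
      ⟨hI f hf d, homogeneousComponent_isHomogeneous d f⟩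
    rcases lt_trichotomy d s with h | rfl | h
    · rw [hlow d h, Submodule.mem_bot] at hd
      rw [hd]
      exact zero_mem _
    · exact combinations_le_span (A.gradedPiece_le_combinations hg₀ h₀ hd)
    · obtain ⟨t, rfl⟩ := Nat.exists_eq_add_of_le h
      exact combinations_le_span (hcomb t hd)

lemma eval_eq_zero_of_syzygy (d : ℕ) (v : Option (Fin nw ⊕ Fin nu ⊕ Fin np) → MvPolynomial (Fin 3) k)
    (hv : ∀ i, v i ∈ shiftPiece (Fin 3) k d (generatorDegrees s nw nu np i))
    (hv0 : ∑ i, v i * generators g₀ w u p i = 0) (j : Fin nw ⊕ Fin nu ⊕ Fin np)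
    (hj : d < syzygyDegrees s nw nu np j) : eval q (v (some j)) = 0 := by
  have hsg : ∀ i, s ≤ generatorDegrees s nw nu np i := by
    rintro (_ | i | i | i) <;> simp [generatorDegrees]
  have hconst : ∀ f : MvPolynomial (Fin 3) k, f.IsHomogeneous 0 → f = C (eval q f) := by
    intro f hf
    refine sub_eq_zero.1 (eq_zero_of_isHomogeneous_zero_of_eval (q := q) ?_ (by simp))
    exact hf.sub (isHomogeneous_C _ _)
  have hj2 : d < s + 2 := hj.trans_le (by rcases j with j | j <;> simp [syzygyDegrees])
  rw [Fintype.sum_option, Fintype.sum_sum_type, Fintype.sum_sum_type] at hv0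
  simp only [generators] at hv0
  have hn := isHomogeneous_of_mem_shiftPiece (hv none)
  have hw := fun i => isHomogeneous_of_mem_shiftPiece (hv (some (.inl i)))
  have hu := fun i => isHomogeneous_of_mem_shiftPiece (hv (some (.inr (.inl i))))
  have hp := fun i => isHomogeneous_of_mem_shiftPiece (hv (some (.inr (.inr i))))
  simp only [generatorDegrees] at hn hw hu hp
  have hew := fun i => (mem_vanishingPiece.1 (A.w_mem i)).2
  have heu := fun i => (mem_vanishingPiece.1 (A.u_mem i)).2
  have hep := fun i => (mem_vanishingPiece.1 (A.p_mem i)).2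
  have hn0 : eval q (v none) = 0 := by
    have := congrArg (eval q) hv0
    simp only [map_add, map_sum, map_mul, hew, heu, hep, mul_zero, Finset.sum_const_zero, add_zero,
      map_zero] at this
    exact (mul_eq_zero.1 this).resolve_right h₀
  rcases lt_trichotomy d s with hd | rfl | hd
  · rw [eq_zero_of_mem_shiftPiece (hd.trans_le (hsg _)) (hv (some j)), map_zero]
  · simp only [Nat.sub_self] at hn hw hu
    have hp0 : ∀ i, v (some (.inr (.inr i))) = 0 := fun i =>
      eq_zero_of_mem_shiftPiece (by simp [generatorDegrees]) (hv _)
    rw [hconst _ hn, hn0, map_zero, zero_mul, zero_add] at hv0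
    have hsum : ∑ i, eval q (v (some (.inl i))) • w i +
        ∑ i, eval q (v (some (.inr (.inl i)))) • u i = 0 := by
      rw [← hv0]
      simp only [hp0, zero_mul, Finset.sum_const_zero, add_zero]
      congr 1 <;> refine Finset.sum_congr rfl fun i _ => ?_
      · conv_rhs => rw [hconst _ (hw i)]
        rw [smul_eq_C_mul]
      · conv_rhs => rw [hconst _ (hu i)]
        rw [smul_eq_C_mul]
    have hu0 := A.u_indep (fun i => eval q (v (some (.inr (.inl i))))) (by
      rw [eq_neg_of_add_eq_zero_right hsum, mul_neg, Finset.mul_sum]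
      refine neg_mem (Submodule.sum_mem _ fun i _ => ?_)
      rw [mul_smul_comm]
      exact Submodule.smul_mem _ _ (A.x_mul_w_mem i))
    have hw0 := A.w_indep (fun i => eval q (v (some (.inl i)))) (by
      rw [← hsum, left_eq_add]
      exact Finset.sum_eq_zero fun i _ => by rw [congrFun hu0 i, Pi.zero_apply, zero_smul])
    rcases j with j | j | j
    · exact congrFun hw0 j
    · exact congrFun hu0 j
    · rw [hp0, map_zero]
  · obtain rfl : d = s + 1 := by omega
    simp only [Nat.sub_self, Nat.add_sub_cancel_left] at hn hw hu hp
    have hp0 := A.p_indep (fun i => eval q (v (some (.inr (.inr i))))) (by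
      have : ∑ i, eval q (v (some (.inr (.inr i)))) • p i =
          -(v none * g₀ + ∑ i, v (some (.inl i)) * w i + ∑ i, v (some (.inr (.inl i))) * u i) := by
        rw [eq_neg_iff_add_eq_zero, ← hv0, add_comm]
        simp only [add_assoc]
        congr 3
        refine Finset.sum_congr rfl fun i _ => ?_
        conv_rhs => rw [hconst _ (hp i)]
        rw [smul_eq_C_mul]
      rw [this]
      refine neg_mem (add_mem (add_mem (F.linear_mul_mem_tripleMul hn hg₀) ?_) ?_)
      · exact Submodule.sum_mem _ fun i _ => F.linear_mul_mem_tripleMul (hw i) (A.w_mem i).1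
      · exact Submodule.sum_mem _ fun i _ => F.linear_mul_mem_tripleMul (hu i) (A.u_mem i).1)
    have hp0' : ∀ i, v (some (.inr (.inr i))) = 0 := fun i => by
      rw [hconst _ (hp i), congrFun hp0 i, Pi.zero_apply, map_zero]
    have hlin : ∀ l f : MvPolynomial (Fin 3) k, l.IsHomogeneous 1 → f ∈ gradedPiece I s →
        l * f - eval q l • (x * f) ∈ pairMul y z (gradedPiece I s) := fun l f hl hf => by
      obtain ⟨l₁, l₂, h₁, h₂, e⟩ := F.expand (t := 0) hl
      refine mem_pairMul.2 ⟨eval q l₁ • f, Submodule.smul_mem _ _ hf, eval q l₂ • f,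
        Submodule.smul_mem _ _ hf, ?_⟩
      rw [smul_eq_C_mul, smul_eq_C_mul, smul_eq_C_mul, ← hconst _ h₁, ← hconst _ h₂]
      linear_combination f * e
    have hu0 := A.u_indep (fun i => eval q (v (some (.inr (.inl i))))) (by
      have : x * ∑ i, eval q (v (some (.inr (.inl i)))) • u i =
          -((v none * g₀ - eval q (v none) • (x * g₀)) +
            ∑ i, (v (some (.inl i)) * w i - eval q (v (some (.inl i))) • (x * w i)) +
            ∑ i, (v (some (.inr (.inl i))) * u i -
              eval q (v (some (.inr (.inl i)))) • (x * u i)) +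
            ∑ i, eval q (v (some (.inl i))) • (x * w i)) := by
        simp only [hp0', zero_mul, Finset.sum_const_zero, add_zero] at hv0
        simp only [hn0, zero_smul, sub_zero, Finset.sum_sub_distrib, Finset.mul_sum,
          mul_smul_comm]
        linear_combination hv0
      rw [this]
      refine neg_mem (add_mem (add_mem (add_mem (hlin _ _ hn hg₀) ?_) ?_) ?_)
      · exact Submodule.sum_mem _ fun i _ => hlin _ _ (hw i) (A.w_mem i).1
      · exact Submodule.sum_mem _ fun i _ => hlin _ _ (hu i) (A.u_mem i).1
      · exact Submodule.sum_mem _ fun i _ => Submodule.smul_mem _ _ (A.x_mul_w_mem i))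
    rcases j with j | j | j
    · simp [syzygyDegrees] at hj
    · exact congrFun hu0 j
    · exact congrFun hp0 j

lemma hasRegularity (hz : ∀ f, z * f ∈ I → f ∈ I)
    (hI : ∀ f ∈ I, ∀ d, homogeneousComponent d f ∈ I) (hlow : ∀ t < s, gradedPiece I t = ⊥)
    (hs : 1 ≤ s) (H : FullModulo I z s) {r : ℕ}
    (hb : ∀ i, generatorDegrees s nw nu np i ≤ r) (ha : ∀ j, syzygyDegrees s nw nu np j ≤ r + 1)
    (hr : (∃ i, generatorDegrees s nw nu np i = r) ∨ ∃ j, syzygyDegrees s nw nu np j = r + 1) :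
    HasRegularity I r := by
  have hmono : ∀ {V V' : Submodule k (MvPolynomial (Fin 3) k)}, V ≤ V' →
      pairMul y z V ≤ pairMul y z V' := fun h => sup_le_sup (Submodule.map_mono h)
    (Submodule.map_mono h)
  have hle := A.gradedPiece_le_combinations hg₀ h₀
  have hle' := A.gradedPiece_succ_le_combinations F hg₀ h₀
  obtain ⟨κ, h₁, h₂, h₃⟩ := F.exists_syzygies (b := generatorDegrees s nw nu np)
    (a := syzygyDegrees s nw nu np) (g := generators g₀ w u p) (by
      rintro (j | j | j)
      · exact ⟨s, 1, rfl, Nat.add_comm _ _, by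
          simpa [generators] using hmono hle (A.x_mul_w_mem j)⟩
      · obtain ⟨t, rfl⟩ := Nat.exists_eq_add_of_le' hs
        exact ⟨t + 1 + 1, 2, rfl, Nat.add_comm _ _, hmono hle' (F.pow_mul_mem_pairMul hz H
          (A.u_mem j).1 (mem_vanishingPiece.1 (A.u_mem j)).2 rfl)⟩
      · exact ⟨s + 1, 1, rfl, (by simp [syzygyDegrees, generatorDegrees]; omega),
          hmono hle' (F.pow_mul_mem_pairMul hz H (A.p_mem j).1
            (mem_vanishingPiece.1 (A.p_mem j)).2 rfl)⟩)
  refine F.hasRegularity hz (fun i => (A.generators_mem hg₀ i).2)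
    (A.span_generators F hg₀ h₀ hz hI hlow H) h₁ h₂ h₃ h₀
    (A.eval_eq_zero_of_syzygy F hg₀ h₀) ?_ ?_ hb ha hr
  · rintro (j | j | j) <;> simp [syzygyDegrees, generatorDegrees]
  · rintro (j | j | j) <;> simp [syzygyDegrees, generatorDegrees]

end IsAdapted

end Adapted

lemma fin_eq_zero_of_forall_eq_zero {n : ℕ} (h : ∀ c : Fin n → k, c = 0) : n = 0 := by
  rcases Nat.eq_zero_or_pos n with h0 | h0
  · exact h0
  · exact absurd (congrFun (h 1) ⟨0, h0⟩) one_ne_zero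

lemma IsFrame.hasRegularity_of_fullModulo_pred (F : IsFrame q x y z)
    (hz : ∀ f, z * f ∈ I → f ∈ I) (hI : ∀ f ∈ I, ∀ d, homogeneousComponent d f ∈ I) {m : ℕ}
    (hlow : ∀ t < m + 1, gradedPiece I t = ⊥) {g₀ : MvPolynomial (Fin 3) k}
    (hg₀ : g₀ ∈ gradedPiece I (m + 1)) (h₀ : eval q g₀ ≠ 0) (H : FullModulo I z m) :
    HasRegularity I (m + 1) := by
  obtain ⟨nw, nu, np, w, u, p, A⟩ := exists_isAdapted I q x y z (m + 1)
  obtain rfl : nu = 0 := fin_eq_zero_of_forall_eq_zero fun c => A.u_indep c (by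
    have hmem : ∑ i, c i • u i ∈ vanishingPiece I q (m + 1) :=
      Submodule.sum_mem _ fun i _ => Submodule.smul_mem _ _ (A.u_mem i)
    simpa using F.pow_mul_mem_pairMul hz (e := 1) H hmem.1 (mem_vanishingPiece.1 hmem).2 rfl)
  obtain rfl : np = 0 := fin_eq_zero_of_forall_eq_zero fun c => A.p_indep c
    (F.gradedPiece_le_tripleMul hz H
      (Submodule.sum_mem _ fun i _ => Submodule.smul_mem _ _ (A.p_mem i).1))
  refine A.hasRegularity F hg₀ h₀ hz hI hlow (Nat.succ_pos m) (F.fullModulo_succ H) ?_ ?_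
    (Or.inl ⟨none, rfl⟩)
  · rintro (_ | i | i | i)
    exacts [le_rfl, le_rfl, le_rfl, i.elim0]
  · rintro (i | i | i)
    exacts [le_rfl, i.elim0, i.elim0]

lemma IsFrame.hasRegularity_of_finrank_lt (F : IsFrame q x y z)
    (hz : ∀ f, z * f ∈ I → f ∈ I) (hI : ∀ f ∈ I, ∀ d, homogeneousComponent d f ∈ I) {s : ℕ}
    (hs : 1 ≤ s) (hlow : ∀ t < s, gradedPiece I t = ⊥) {g₀ : MvPolynomial (Fin 3) k}
    (hg₀ : g₀ ∈ gradedPiece I s) (h₀ : eval q g₀ ≠ 0) (H : FullModulo I z s)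
    (hrank : 1 + 2 * Module.finrank k (gradedPiece I s) <
      Module.finrank k (gradedPiece I (s + 1))) :
    HasRegularity I (s + 1) := by
  obtain ⟨nw, nu, np, w, u, p, A⟩ := exists_isAdapted I q x y z s
  refine A.hasRegularity F hg₀ h₀ hz hI hlow hs H ?_ ?_ (Or.inr ?_)
  · rintro (_ | i | i | i) <;> simp [generatorDegrees]
  · rintro (i | i) <;> simp [syzygyDegrees]
  · by_contra hne
    have hnu : nu = 0 := by
      by_contra h
      exact hne ⟨.inr (.inl ⟨0, Nat.pos_of_ne_zero h⟩), rfl⟩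
    have hnp : np = 0 := by
      by_contra h
      exact hne ⟨.inr (.inr ⟨0, Nat.pos_of_ne_zero h⟩), rfl⟩
    subst hnu hnp
    have hle : gradedPiece I (s + 1) ≤
        Submodule.span k {x * g₀} ⊔ pairMul y z (gradedPiece I s) := by
      have hx : ∀ f ∈ gradedPiece I s,
          x * f ∈ Submodule.span k {x * g₀} ⊔ pairMul y z (gradedPiece I s) := fun f hf => by
        obtain ⟨c, c', hc⟩ := A.u_span _ (sub_smul_mem_vanishingPiece hf hg₀ h₀)
        rw [sub_eq_iff_eq_add.1 hc, Finset.univ_eq_empty (α := Fin 0), Finset.sum_empty, add_zero,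
          mul_add, Finset.mul_sum, add_comm, mul_smul_comm]
        refine Submodule.add_mem_sup
          (Submodule.smul_mem _ _ (Submodule.mem_span_singleton_self _))
          (Submodule.sum_mem _ fun i _ => ?_)
        rw [mul_smul_comm]
        exact Submodule.smul_mem _ _ (A.x_mul_w_mem i)
      intro f hf
      obtain ⟨c, hc⟩ := A.p_span _ (sub_smul_mem_vanishingPiece hf
        (mul_mem_gradedPiece F.x_hom hg₀) (by rwa [map_mul, F.eval_x, one_mul]))
      rw [Finset.univ_eq_empty (α := Fin 0), Finset.sum_empty, sub_zero] at hc
      obtain ⟨f₀, hf₀, f₁, hf₁, f₂, hf₂, e⟩ := mem_tripleMul.1 hc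
      rw [sub_eq_iff_eq_add.1 e, add_assoc (x * f₀)]
      exact add_mem (add_mem (hx f₀ hf₀)
        (Submodule.mem_sup_right (mem_pairMul.2 ⟨f₁, hf₁, f₂, hf₂, rfl⟩)))
        (Submodule.mem_sup_left (Submodule.smul_mem _ _ (Submodule.mem_span_singleton_self _)))
    have : Module.Finite k (pairMul y z (gradedPiece I s)) := by
      unfold pairMul
      infer_instance
    have h1 := Submodule.finrank_mono hle
    have h2 := Submodule.finrank_add_le_finrank_add_finrank
      (Submodule.span k {x * g₀}) (pairMul y z (gradedPiece I s))
    have h3 : Module.finrank k (pairMul y z (gradedPiece I s)) ≤ _ :=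
      Submodule.finrank_add_le_finrank_add_finrank
        ((gradedPiece I s).map (LinearMap.mulLeft k y))
        ((gradedPiece I s).map (LinearMap.mulLeft k z))
    have h4 := Submodule.finrank_map_le (LinearMap.mulLeft k y) (gradedPiece I s)
    have h5 := Submodule.finrank_map_le (LinearMap.mulLeft k z) (gradedPiece I s)
    have h6 : Module.finrank k (Submodule.span k {x * g₀}) ≤ 1 := by
      simpa using finrank_span_le_card (R := k) ({x * g₀} : Set (MvPolynomial (Fin 3) k))
    omega

end Construction

section Points

variable {k : Type*} [Field k]

lemma MvPolynomial.IsHomogeneous.eval_smul_point {f : MvPolynomial (Fin 3) k} {t : ℕ}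
    (hf : f.IsHomogeneous t) (c : k) (p : Fin 3 → k) : eval (c • p) f = c ^ t * eval p f := by
  rw [eval_eq', eval_eq', Finset.mul_sum]
  refine Finset.sum_congr rfl fun d hd => ?_
  have hdeg : ∑ i, d i = t := by
    rw [← Finsupp.degree_eq_sum, ← hf (mem_support_iff.1 hd), Finsupp.degree_eq_weight_one]
    rfl
  simp only [Pi.smul_apply, smul_eq_mul, mul_pow, Finset.prod_mul_distrib, Finset.prod_pow_eq_pow_sum,
    hdeg]
  ring

lemma linearForm_isHomogeneous (a : Fin 3 → k) :
    (Fintype.linearCombination k (X : Fin 3 → MvPolynomial (Fin 3) k) a).IsHomogeneous 1 := by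
  rw [Fintype.linearCombination_apply]
  refine IsHomogeneous.sum _ _ _ fun i _ => ?_
  rw [smul_eq_C_mul]
  simpa using (isHomogeneous_C (Fin 3) (a i)).mul (isHomogeneous_X k i)

lemma exists_eq_linearForm {l : MvPolynomial (Fin 3) k} (hl : l.IsHomogeneous 1) :
    ∃ a : Fin 3 → k, Fintype.linearCombination k (X : Fin 3 → MvPolynomial (Fin 3) k) a = l := by
  have : l ∈ homogeneousSubmodule (Fin 3) k 1 := hl
  rw [homogeneousSubmodule_one_eq_span_X, ← Fintype.range_linearCombination] at this
  exact this

lemma eval_linearForm (p a : Fin 3 → k) :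
    eval p (Fintype.linearCombination k (X : Fin 3 → MvPolynomial (Fin 3) k) a) = a ⬝ᵥ p := by
  simp [Fintype.linearCombination_apply, dotProduct, smul_eq_C_mul]

lemma linearForm_ne_zero {a : Fin 3 → k} (ha : a ≠ 0) :
    Fintype.linearCombination k (X : Fin 3 → MvPolynomial (Fin 3) k) a ≠ 0 := by
  intro h
  refine ha (funext fun i => ?_)
  have := eval_linearForm (Pi.single i 1) a
  rw [h] at this
  simpa using this.symm

/-- Restriction of polynomials to the line through the origin and `p`. -/
noncomputable def restrictLine (p : Fin 3 → k) : MvPolynomial (Fin 3) k →ₐ[k] Polynomial k :=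
  aeval fun i => Polynomial.C (p i) * Polynomial.X

lemma restrictLine_of_isHomogeneous_one (p : Fin 3 → k) {l : MvPolynomial (Fin 3) k}
    (hl : l.IsHomogeneous 1) :
    restrictLine p l = Polynomial.C (eval p l) * Polynomial.X := by
  obtain ⟨a, rfl⟩ := exists_eq_linearForm hl
  rw [eval_linearForm]
  simp [restrictLine, Fintype.linearCombination_apply, dotProduct, Finset.sum_mul,
    Polynomial.smul_eq_C_mul, mul_assoc]

lemma mem_pointIdeal_iff {p : Fin 3 → k} (hp : p ≠ 0) {f : MvPolynomial (Fin 3) k} :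
    f ∈ pointIdeal p ↔ restrictLine p f = 0 := by
  constructor
  · suffices pointIdeal p ≤ RingHom.ker (restrictLine p) from fun h => this h
    refine Ideal.span_le.2 ?_
    rintro l ⟨hl, h0⟩
    simp [RingHom.mem_ker, restrictLine_of_isHomogeneous_one p hl, h0]
  · intro h
    obtain ⟨j, hj⟩ := Function.ne_iff.1 hp
    simp only [Pi.zero_apply] at hj
    let φ : Polynomial k →ₐ[k] MvPolynomial (Fin 3) k := Polynomial.aeval (C (p j)⁻¹ * X j)
    have key : (Ideal.Quotient.mkₐ k (pointIdeal p)).comp (φ.comp (restrictLine p)) =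
        Ideal.Quotient.mkₐ k (pointIdeal p) := by
      ext i
      simp only [AlgHom.comp_apply, Ideal.Quotient.mkₐ_eq_mk]
      refine Ideal.Quotient.eq.2 (Ideal.subset_span ⟨?_, ?_⟩)
      · simp only [restrictLine, aeval_X, map_mul, φ, Polynomial.aeval_C, Polynomial.aeval_X,
          algebraMap_eq]
        refine IsHomogeneous.sub ?_ (isHomogeneous_X k i)
        rw [← mul_assoc, ← C_mul]
        simpa using (isHomogeneous_C (Fin 3) (p i * (p j)⁻¹)).mul (isHomogeneous_X k j)
      · simp [restrictLine, φ, hj]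
    have := congrArg (fun ψ => ψ f) key
    simp only [AlgHom.comp_apply, h, map_zero] at this
    exact Ideal.Quotient.eq_zero_iff_mem.1 this.symm

lemma mem_pointIdeal_of_mul_mem {p : Fin 3 → k} (hp : p ≠ 0) {z f : MvPolynomial (Fin 3) k}
    (hz : z.IsHomogeneous 1) (h : eval p z ≠ 0) (hf : z * f ∈ pointIdeal p) :
    f ∈ pointIdeal p := by
  rw [mem_pointIdeal_iff hp, map_mul, restrictLine_of_isHomogeneous_one p hz] at hf
  rw [mem_pointIdeal_iff hp]
  simpa [h] using hf

lemma eval_eq_zero_of_mem_pointIdeal {p : Fin 3 → k} {f : MvPolynomial (Fin 3) k}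
    (hf : f ∈ pointIdeal p) : eval p f = 0 := by
  suffices pointIdeal p ≤ RingHom.ker (eval p) from this hf
  exact Ideal.span_le.2 fun l hl => hl.2

attribute [local instance] MvPolynomial.gradedAlgebra in
lemma homogeneousComponent_mem_vanishingIdeal {n : ℕ} (pts : Fin n → (Fin 3 → k))
    {f : MvPolynomial (Fin 3) k} (hf : f ∈ _root_.vanishingIdeal pts) (d : ℕ) :
    homogeneousComponent d f ∈ _root_.vanishingIdeal pts := by
  refine homogeneousComponent_mem_of_mem (Ideal.IsHomogeneous.iInf fun i => ?_) hf d
  exact Ideal.homogeneous_span _ _ fun l hl => ⟨1, hl.1⟩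

/-- A linear form through `q` that avoids finitely many points different from `q`. -/
lemma exists_dotProduct_ne_zero [Infinite k] {n : ℕ} {pts : Fin n → (Fin 3 → k)} {q : Fin 3 → k}
    (hq : q ≠ 0) (h : ∀ j (c : k), pts j ≠ c • q) :
    ∃ a : Fin 3 → k, a ⬝ᵥ q = 0 ∧ ∀ j, a ⬝ᵥ pts j ≠ 0 := by
  have := Module.Dual.exists_forall_mem_ne_zero_of_forall_exists
    (LinearMap.ker (Fintype.linearCombination k q)) (fun j => Fintype.linearCombination k (pts j))
    (fun j => ?_)
  · simpa [Fintype.linearCombination_apply, dotProduct] using this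
  obtain ⟨m, hm⟩ := Function.ne_iff.1 hq
  simp only [Pi.zero_apply] at hm
  by_contra! H
  refine h j (pts j m / q m) (funext fun i => ?_)
  have := H (Pi.single i (q m) - Pi.single m (q i)) (by
    simp [LinearMap.mem_ker, mul_comm])
  simp only [map_sub, Fintype.linearCombination_apply_single, smul_eq_mul, sub_eq_zero] at this
  rw [Pi.smul_apply, smul_eq_mul]
  field_simp
  linear_combination this

lemma exists_dotProduct_eq_one {q : Fin 3 → k} (hq : q ≠ 0) : ∃ c : Fin 3 → k, c ⬝ᵥ q = 1 := by
  obtain ⟨m, hm⟩ := Function.ne_iff.1 hq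
  simp only [Pi.zero_apply] at hm
  exact ⟨Pi.single m (q m)⁻¹, by simp [hm]⟩

lemma prime_linearForm {a : Fin 3 → k} (ha : a ≠ 0) :
    Prime (Fintype.linearCombination k (X : Fin 3 → MvPolynomial (Fin 3) k) a) := by
  have h0 := linearForm_ne_zero ha
  refine (irreducible_of_totalDegree_eq_one ((linearForm_isHomogeneous a).totalDegree h0)
    fun c hc => ?_).prime
  refine isUnit_iff_ne_zero.2 fun hc0 => h0 ?_
  ext m
  simpa [hc0] using hc m

lemma exists_isFrame [Infinite k] {n : ℕ} {pts : Fin n → (Fin 3 → k)} (hn : 0 < n) {q : Fin 3 → k}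
    (hq : q ≠ 0) (h : ∀ j (c : k), pts j ≠ c • q) :
    ∃ x y z : MvPolynomial (Fin 3) k, IsFrame q x y z ∧ ∀ j, eval (pts j) z ≠ 0 := by
  obtain ⟨a, haq, ha⟩ := exists_dotProduct_ne_zero hq h
  have ha0 : a ≠ 0 := by
    rintro rfl
    exact ha ⟨0, hn⟩ (zero_dotProduct _)
  obtain ⟨c, hc⟩ := exists_dotProduct_eq_one hq
  obtain ⟨w, hw⟩ := exists_dotProduct_eq_one ha0
  let b := crossProduct q w
  let r := crossProduct c a
  have hbq : b ⬝ᵥ q = 0 := by rw [dotProduct_comm]; exact dot_self_cross q w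
  have har : a ⬝ᵥ r = 0 := dot_cross_self c a
  have hcr : c ⬝ᵥ r = 0 := dot_self_cross c a
  have hbr : b ⬝ᵥ r = 1 := by
    rw [cross_dot_cross, dotProduct_comm q c, hc, hw, dotProduct_comm q a, haq]
    simp
  let L := Fintype.linearCombination k (X : Fin 3 → MvPolynomial (Fin 3) k)
  have hli : LinearIndependent k ![c, b, a] := by
    refine Fintype.linearIndependent_iff.2 fun g hg => ?_
    simp only [Fin.sum_univ_three, Matrix.cons_val] at hg
    have h0 : g 0 = 0 := by
      simpa [add_dotProduct, hc, hbq, haq] using congrArg (· ⬝ᵥ q) hg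
    have h1 : g 1 = 0 := by
      simpa [add_dotProduct, hcr, hbr, har] using congrArg (· ⬝ᵥ r) hg
    have h2 : g 2 = 0 := by simpa [h0, h1, ha0] using hg
    intro i
    fin_cases i <;> assumption
  have hspan : Submodule.span k {c, b, a} = ⊤ := by
    have := hli.span_eq_top_of_card_eq_finrank (by simp)
    rwa [Matrix.range_cons, Matrix.range_cons, Matrix.range_cons, Matrix.range_empty,
      Set.union_empty] at this
  refine ⟨L c, L b, L a, ⟨linearForm_isHomogeneous c, linearForm_isHomogeneous b,
    linearForm_isHomogeneous a, ?_, ?_, ?_, ?_, ?_⟩, ?_⟩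
  · rw [eval_linearForm, hc]
  · rw [eval_linearForm, hbq]
  · rw [eval_linearForm, haq]
  · intro l hl
    obtain ⟨e, rfl⟩ := exists_eq_linearForm hl
    have := Submodule.mem_map_of_mem (f := L) (hspan ▸ Submodule.mem_top (x := e))
    rwa [Submodule.map_span, Set.image_insert_eq, Set.image_pair] at this
  · intro f g hfg
    have hprime := prime_linearForm ha0
    have hdvd : L a ∣ L b * f := ⟨-g, by linear_combination hfg⟩
    rcases hprime.dvd_or_dvd hdvd with ⟨e, he⟩ | ⟨e, rfl⟩
    · have := congrArg (eval r) he
      rw [map_mul, eval_linearForm, eval_linearForm, har, hbr] at this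
      simp at this
    · exact ⟨e, rfl, mul_left_cancel₀ hprime.ne_zero (by linear_combination hfg)⟩
  · intro j
    rw [eval_linearForm]
    exact ha j

end Points

section Dimension

variable {k : Type*} [Field k] {q : Fin 3 → k} {x y z : MvPolynomial (Fin 3) k}

instance (t : ℕ) : Module.Finite k (homogeneousSubmodule (Fin 3) k t) :=
  Module.Finite.iff_fg.2 (homogeneousSubmodule_fg (Fin 3) k t)

lemma IsFrame.exists_homogeneousSubmodule_le (F : IsFrame q x y z) (t : ℕ) :
    ∃ D : Submodule k (MvPolynomial (Fin 3) k), Module.Finite k D ∧ Module.finrank k D ≤ t + 2 ∧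
      homogeneousSubmodule (Fin 3) k (t + 1) ≤
        D ⊔ (homogeneousSubmodule (Fin 3) k t).map (LinearMap.mulLeft k z) := by
  induction t with
  | zero =>
    refine ⟨Submodule.span k {x, y}, Module.Finite.span_of_finite k (Set.toFinite _), ?_,
      fun f hf => ?_⟩
    · classical
      have := finrank_span_finset_le_card (R := k) ({x, y} : Finset (MvPolynomial (Fin 3) k))
      rw [Finset.coe_pair] at this
      exact this.trans Finset.card_le_two
    · obtain ⟨a, b, c, rfl⟩ := Submodule.mem_span_triple.1 (F.mem_span f hf)
      refine Submodule.mem_sup.2 ⟨a • x + b • y, Submodule.mem_span_pair.2 ⟨a, b, rfl⟩, c • z,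
        ⟨C c, isHomogeneous_C _ _, ?_⟩, rfl⟩
      simp [smul_eq_C_mul, mul_comm]
  | succ t ih =>
    obtain ⟨D, hD, hrank, hle⟩ := ih
    refine ⟨Submodule.span k {x ^ (t + 1 + 1)} ⊔ D.map (LinearMap.mulLeft k y), inferInstance, ?_,
      fun f hf => ?_⟩
    · classical
      have h₁ := Submodule.finrank_add_le_finrank_add_finrank
        (Submodule.span k {x ^ (t + 1 + 1)}) (D.map (LinearMap.mulLeft k y))
      have h₂ := Submodule.finrank_map_le (LinearMap.mulLeft k y) D
      have h₃ : Module.finrank k (Submodule.span k {x ^ (t + 1 + 1)}) ≤ 1 := by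
        simpa using finrank_span_le_card (R := k) {x ^ (t + 1 + 1)}
      omega
    · obtain ⟨f₁, f₂, h₁, h₂, e⟩ := F.expand hf
      obtain ⟨d, hd, _, ⟨r, hr, rfl⟩, rfl⟩ := Submodule.mem_sup.1 (hle h₁)
      refine Submodule.mem_sup.2 ⟨eval q f • x ^ (t + 1 + 1) + y * d,
        Submodule.mem_sup.2 ⟨_, Submodule.smul_mem _ _ (Submodule.mem_span_singleton_self _), _,
          ⟨d, hd, rfl⟩, rfl⟩, z * (y * r + f₂), ⟨_, IsHomogeneous.add ?_ h₂, rfl⟩, ?_⟩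
      · simpa [add_comm] using F.y_hom.mul hr
      · rw [smul_eq_C_mul]
        conv_rhs => rw [e]
        simp only [LinearMap.mulLeft_apply]
        ring

lemma IsFrame.fullModulo_of_finrank (F : IsFrame q x y z) {I : Ideal (MvPolynomial (Fin 3) k)}
    (hz : ∀ f, z * f ∈ I → f ∈ I) (hz0 : z ≠ 0) {m : ℕ}
    (hrank : Module.finrank k (gradedPiece I (m + 1)) =
      Module.finrank k (gradedPiece I m) + (m + 2)) : FullModulo I z m := by
  obtain ⟨D, hD, hDrank, hle⟩ := F.exists_homogeneousSubmodule_le m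
  set Z := (homogeneousSubmodule (Fin 3) k m).map (LinearMap.mulLeft k z) with hZ
  have hinj : Function.Injective (LinearMap.mulLeft k z) :=
    fun f g hfg => mul_left_cancel₀ hz0 hfg
  have hinf : gradedPiece I (m + 1) ⊓ Z = (gradedPiece I m).map (LinearMap.mulLeft k z) := by
    ext f
    constructor
    · rintro ⟨hf, r, hr, rfl⟩
      exact ⟨r, ⟨hz r hf.1, hr⟩, rfl⟩
    · rintro ⟨r, hr, rfl⟩
      exact ⟨mul_mem_gradedPiece F.z_hom hr, r, hr.2, rfl⟩
  have hZle : Z ≤ homogeneousSubmodule (Fin 3) k (m + 1) := by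
    rintro _ ⟨r, hr, rfl⟩
    simpa [add_comm] using F.z_hom.mul hr
  have hsum := Submodule.finrank_sup_add_finrank_inf_eq (gradedPiece I (m + 1)) Z
  rw [hinf, ← (Submodule.equivMapOfInjective _ hinj _).finrank_eq] at hsum
  have htop : gradedPiece I (m + 1) ⊔ Z = homogeneousSubmodule (Fin 3) k (m + 1) := by
    refine Submodule.eq_of_le_of_finrank_le (sup_le inf_le_right hZle) ?_
    have h₁ := Submodule.finrank_mono hle
    have h₂ := Submodule.finrank_add_le_finrank_add_finrank D Z
    omega
  intro f hf
  have hf' : f ∈ homogeneousSubmodule (Fin 3) k (m + 1) := hf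
  rw [← htop] at hf'
  obtain ⟨i, hi, _, ⟨r, hr, rfl⟩, e⟩ := Submodule.mem_sup.1 hf'
  exact ⟨i, hi, r, hr, e.symm⟩

end Dimension

/-- Let `I ⊂ k[x,y,z]` be the radical ideal of `n` distinct points of `ℙ²`
in generic `n`-position, with initial degree `s ≥ 2`, and write `n = C(s+1,2) + h`,
`0 ≤ h ≤ s`.  Then `reg I = s` if `h = 0` and `reg I = s + 1` otherwise. -/
theorem statement11 {k : Type*} [Field k] [IsAlgClosed k] {n s h : ℕ}
    (pts : Fin n → (Fin 3 → k)) (hfam : IsPointFamily pts)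
    (hgen : InGenericPosition pts)
    (hindeg : HasInitialDegree (vanishingIdeal pts) s)
    (hs : 2 ≤ s) (hn : n = (s + 1).choose 2 + h) (hh : h ≤ s) :
    HasRegularity (vanishingIdeal pts) (if h = 0 then s else s + 1) := by

  obtain ⟨hne, hlow⟩ := hindeg
  obtain ⟨g₀, hg₀, hg₀0⟩ := Submodule.exists_mem_ne_zero_of_ne_bot hne
  obtain ⟨q, h₀⟩ : ∃ q, eval q g₀ ≠ 0 := by
    by_contra! H
    exact hg₀0 (MvPolynomial.funext fun q => by simpa using H q)
  have hmem : ∀ {f}, f ∈ _root_.vanishingIdeal pts ↔ ∀ j, f ∈ pointIdeal (pts j) :=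
    Submodule.mem_iInf _
  have hhom : ∀ (c : k) (p : Fin 3 → k), eval (c • p) g₀ = c ^ s * eval p g₀ :=
    hg₀.2.eval_smul_point
  have hq : q ≠ 0 := by
    rintro rfl
    refine h₀ ?_
    simpa [show s ≠ 0 by omega] using hhom 0 0
  have hpq : ∀ j (c : k), pts j ≠ c • q := by
    intro j c hc
    have h1 := eval_eq_zero_of_mem_pointIdeal (hmem.1 hg₀.1 j)
    rw [hc, hhom] at h1
    have hc0 : c = 0 := by simpa [h₀, show s ≠ 0 by omega] using h1
    exact hfam.1 j (by simp [hc, hc0])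
  have hchoose : (s + 2).choose 2 = (s + 1).choose 2 + (s + 1) := by
    rw [Nat.choose_succ_succ' (s + 1) 1, Nat.choose_one_right, add_comm]
  have hchoose' : (s + 3).choose 2 = (s + 2).choose 2 + (s + 2) := by
    rw [Nat.choose_succ_succ' (s + 2) 1, Nat.choose_one_right, add_comm]
  have hpos : 0 < (s + 1).choose 2 := Nat.choose_pos (by omega)
  obtain ⟨x, y, z, F, hzp⟩ := exists_isFrame (by omega) hq hpq
  have hz : ∀ f, z * f ∈ _root_.vanishingIdeal pts → f ∈ _root_.vanishingIdeal pts :=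
    fun f hf => hmem.2 fun j =>
      mem_pointIdeal_of_mul_mem (hfam.1 j) F.z_hom (hzp j) (hmem.1 hf j)
  have hz0 : z ≠ 0 := by
    rintro rfl
    exact hzp ⟨0, by omega⟩ (map_zero _)
  have hI : ∀ f ∈ _root_.vanishingIdeal pts, ∀ d,
      homogeneousComponent d f ∈ _root_.vanishingIdeal pts :=
    fun f hf d => homogeneousComponent_mem_vanishingIdeal pts hf d
  have hs₀ := hgen s
  have hs₁ := hgen (s + 1)
  rw [show s + 1 + 2 = s + 3 by omega] at hs₁
  split_ifs with hh0
  · obtain ⟨m, rfl⟩ : ∃ m, s = m + 1 := ⟨s - 1, by omega⟩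
    refine F.hasRegularity_of_fullModulo_pred hz hI hlow hg₀ h₀
      (F.fullModulo_of_finrank hz hz0 ?_)
    rw [hlow m (by omega), finrank_bot]
    omega
  · refine F.hasRegularity_of_finrank_lt hz hI (by omega) hlow hg₀ h₀
      (F.fullModulo_of_finrank hz hz0 ?_) ?_ <;> omega
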